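/- arXiv:math/9404230 — 2 statements merged into one kernel-verified Lean document; each statement's English description precedes it below -/
import Mathlib

section
/- (Approximation reduction.) Suppose that for every centered convex body K₁ in ℝ³ whose radial function ρ_{K₁} is C^∞ on S², and every centered convex body K₂ in ℝ³, the inequalities λ₂(K₁ ∩ u^⊥) ≤ λ₂(K₂ ∩ u^⊥) for all u ∈ S² imply λ₃(K₁) ≤ λ₃(K₂). Then the same implication holds for ALL centered convex bodies K₁, K₂ in ℝ³ (with no smoothness assumption on K₁). -/
open MeasureTheory Metric
open scoped RealInnerProductSpace ENNReal

noncomputable section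

abbrev E (n : ℕ) := EuclideanSpace ℝ (Fin n)

/-- The radial function of a set: `ρ_K(x) = max {c ≥ 0 : c • x ∈ K}`. -/
def radialFn {n : ℕ} (K : Set (E n)) (x : E n) : ℝ :=
  sSup {c : ℝ | 0 ≤ c ∧ c • x ∈ K}

/-- A convex body: compact convex set with nonempty interior. -/
def IsConvexBody {n : ℕ} (K : Set (E n)) : Prop :=
  IsCompact K ∧ Convex ℝ K ∧ (interior K).Nonempty

/-- Centered: symmetric about the origin. -/
def IsCentered {n : ℕ} (K : Set (E n)) : Prop :=
  ∀ x, x ∈ K ↔ -x ∈ K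

/-- The hyperplane through the origin orthogonal to `u`. -/
def hyperplane {n : ℕ} (u : E n) : Set (E n) := {x | ⟪x, u⟫ = 0}

/-- A star body: compact, star-shaped at the origin (contains the origin), with
continuous radial function on the unit sphere. -/
def IsStarBody {n : ℕ} (L : Set (E n)) : Prop :=
  IsCompact L ∧ (0 : E n) ∈ L ∧ StarConvex ℝ 0 L ∧
    ContinuousOn (radialFn L) (sphere (0 : E n) 1)

/-- `L` is the intersection body of `M`: `ρ_L(u) = λ_{n-1}(M ∩ u^⊥)` for `u ∈ S^{n-1}`. -/
def IsIntersectionBodyOf {n : ℕ} (L M : Set (E n)) : Prop :=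
  ∀ u ∈ sphere (0 : E n) 1,
    radialFn L u = (μH[(n : ℝ) - 1] (M ∩ hyperplane u)).toReal

/-- The spherical Radon transform:
`(Rg)(u) = ∫_{S^{n-1} ∩ u^⊥} g dλ_{n-2}`. -/
def radon (n : ℕ) (g : E n → ℝ) (u : E n) : ℝ :=
  ∫ v in (sphere (0 : E n) 1 ∩ hyperplane u), g v ∂μH[(n : ℝ) - 2]

/-- A function on the sphere is C^∞ if its 0-homogeneous extension is smooth
away from the origin. -/
def SmoothOnSphere {n : ℕ} (h : E n → ℝ) : Prop :=
  ContDiffOn ℝ (⊤ : ℕ∞) (fun x : E n => h (‖x‖⁻¹ • x)) {(0 : E n)}ᶜ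

/-- A body of revolution about the axis `u₀`: invariant under every (linear)
isometry of `ℝⁿ` fixing `u₀`. -/
def IsRevolutionBody {n : ℕ} (u₀ : E n) (K : Set (E n)) : Prop :=
  ∀ f : E n ≃ₗᵢ[ℝ] E n, f u₀ = u₀ → f '' K = K

/-- The sublevel set `{x | ∑ f, (f x) ^ (2 * m) ≤ 1}` of an even power sum of linear functionals. -/
def powerSumBody {n : ℕ} (t : Finset (E n →L[ℝ] ℝ)) (m : ℕ) : Set (E n) :=
  {x | ∑ f ∈ t, f x ^ (2 * m) ≤ 1}

theorem convex_powerSumBody {n : ℕ} (t : Finset (E n →L[ℝ] ℝ)) (m : ℕ) :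
    Convex ℝ (powerSumBody t m) := by
  have h : ConvexOn ℝ Set.univ (fun x : E n => ∑ f ∈ t, f x ^ (2 * m)) := by
    refine ⟨convex_univ, fun x _ y _ a b ha hb hab => ?_⟩
    simp only [smul_eq_mul, Finset.mul_sum, ← Finset.sum_add_distrib]
    refine Finset.sum_le_sum fun f _ => ?_
    have := (even_two_mul m).convexOn_pow.2 (Set.mem_univ (f x)) (Set.mem_univ (f y)) ha hb hab
    simpa using this
  simpa [powerSumBody] using h.convex_le 1

theorem isClosed_powerSumBody {n : ℕ} (t : Finset (E n →L[ℝ] ℝ)) (m : ℕ) :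
    IsClosed (powerSumBody t m) :=
  isClosed_le (by fun_prop) continuous_const

theorem isCentered_powerSumBody {n : ℕ} (t : Finset (E n →L[ℝ] ℝ)) (m : ℕ) :
    IsCentered (powerSumBody t m) := fun x => by
  simp [powerSumBody, (even_two_mul m).neg_pow]

theorem zero_mem_interior_powerSumBody {n : ℕ} (t : Finset (E n →L[ℝ] ℝ)) {m : ℕ} (hm : m ≠ 0) :
    (0 : E n) ∈ interior (powerSumBody t m) := by
  refine mem_interior.2 ⟨{x | ∑ f ∈ t, f x ^ (2 * m) < 1}, fun x hx => le_of_lt (Set.mem_ofPred_eq ▸ hx),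
    isOpen_lt (by fun_prop) continuous_const, ?_⟩
  simp [hm]

/-- Away from the zeros of the power sum, the radial function of its sublevel set is an explicit
power of it. -/
theorem radialFn_powerSumBody {n : ℕ} {t : Finset (E n →L[ℝ] ℝ)} {m : ℕ} (hm : m ≠ 0) {x : E n}
    (hx : 0 < ∑ f ∈ t, f x ^ (2 * m)) :
    radialFn (powerSumBody t m) x =
      (∑ f ∈ t, f x ^ (2 * m)) ^ (-((2 * m : ℕ) : ℝ)⁻¹) := by
  set p := ∑ f ∈ t, f x ^ (2 * m) with hp
  have hq : (0 : ℝ) ≤ p ^ (-((2 * m : ℕ) : ℝ)⁻¹) := Real.rpow_nonneg hx.le _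
  have hqp : (p ^ (-((2 * m : ℕ) : ℝ)⁻¹)) ^ (2 * m) = p⁻¹ := by
    rw [Real.rpow_neg hx.le, inv_pow, Real.rpow_inv_natCast_pow hx.le (by simpa using hm)]
  have hset : {c : ℝ | 0 ≤ c ∧ c • x ∈ powerSumBody t m} =
      Set.Icc 0 (p ^ (-((2 * m : ℕ) : ℝ)⁻¹)) := by
    ext c
    simp only [Set.mem_ofPred_eq, Set.mem_Icc, powerSumBody, map_smul, smul_eq_mul, mul_pow,
      ← Finset.mul_sum, ← hp]
    refine and_congr_right fun hc => ?_
    rw [← pow_le_pow_iff_left₀ hc hq (n := 2 * m) (by simpa using hm), hqp, ← one_div,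
      le_div_iff₀ hx]
  rw [radialFn, hset, csSup_Icc hq]

theorem smoothOnSphere_radialFn_powerSumBody {n : ℕ} {t : Finset (E n →L[ℝ] ℝ)} {m : ℕ}
    (hm : m ≠ 0) (hpos : ∀ x : E n, x ≠ 0 → 0 < ∑ f ∈ t, f x ^ (2 * m)) :
    SmoothOnSphere (radialFn (powerSumBody t m)) := by
  have hne : ∀ x ∈ ({0}ᶜ : Set (E n)), ‖x‖⁻¹ • x ≠ 0 := fun x hx =>
    smul_ne_zero (inv_ne_zero (norm_ne_zero_iff.2 hx)) hx
  have hne' : ∀ x ∈ ({0}ᶜ : Set (E n)), x ≠ 0 := fun x hx => hx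
  have hsmul : ContDiffOn ℝ (⊤ : ℕ∞) (fun x : E n => ‖x‖⁻¹ • x) {(0 : E n)}ᶜ :=
    ((contDiffOn_id.norm ℝ hne').inv fun x hx => norm_ne_zero_iff.2 (hne' x hx)).smul contDiffOn_id
  refine ContDiffOn.congr (f := fun x : E n =>
      (∑ f ∈ t, f (‖x‖⁻¹ • x) ^ (2 * m)) ^ (-((2 * m : ℕ) : ℝ)⁻¹)) ?_
    fun x hx => radialFn_powerSumBody hm (hpos _ (hne x hx))
  refine ContDiffOn.rpow_const_of_ne ?_ fun x hx => (hpos _ (hne x hx)).ne'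
  exact ContDiffOn.sum fun f _ => (f.contDiff.comp_contDiffOn hsmul).pow _

theorem IsCentered.zero_mem_interior {n : ℕ} {K : Set (E n)} (hK : IsConvexBody K)
    (hc : IsCentered K) : (0 : E n) ∈ interior K := by
  obtain ⟨x, hx⟩ := hK.2.2
  refine hK.2.1.openSegment_interior_self_subset_interior hx ((hc x).1 (interior_subset hx)) ?_
  exact ⟨1 / 2, 1 / 2, by norm_num, by norm_num, by norm_num, by simp⟩

/-- Finitely many linear functionals, bounded by `r` on `K`, one of which exceeds `1` at any given
point outside `K`. -/
theorem exists_finset_separating {n : ℕ} {K : Set (E n)} (hK : IsConvexBody K)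
    (hc : IsCentered K) {r : ℝ} (hr : 1 < r) :
    ∃ t : Finset (E n →L[ℝ] ℝ), (∀ f ∈ t, ∀ x ∈ K, |f x| ≤ r) ∧
      ∀ x ∉ K, ∃ f ∈ t, 1 < f x := by
  have h0 := hc.zero_mem_interior hK
  have hr0 : 0 < r := one_pos.trans hr
  have hsep : ∀ x ∈ frontier K, ∃ f : E n →L[ℝ] ℝ, (∀ y ∈ K, |f y| ≤ r) ∧ 1 < f x := by
    intro x hx
    have hrx : r • x ∉ K := fun h => hx.2 <|
      hK.2.1.openSegment_interior_self_subset_interior h0 h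
        ⟨1 - r⁻¹, r⁻¹, sub_pos.2 (inv_lt_one_of_one_lt₀ hr), inv_pos.2 hr0, by ring, by
          simp [smul_smul, hr0.ne']⟩
    obtain ⟨f, u, hfu, hux⟩ := geometric_hahn_banach_closed_point hK.2.1 hK.1.isClosed hrx
    have hu : 0 < u := by simpa using hfu 0 (interior_subset h0)
    refine ⟨(r / u) • f, fun y hy => ?_, ?_⟩
    · have h1 := hfu y hy
      have h2 := hfu (-y) ((hc y).1 hy)
      rw [map_neg] at h2
      have h3 : |f y| ≤ u := abs_le.2 ⟨by linarith, h1.le⟩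
      simp only [smul_apply, smul_eq_mul, abs_mul,
        abs_of_pos (div_pos hr0 hu)]
      calc r / u * |f y| ≤ r / u * u := by gcongr
        _ = r := div_mul_cancel₀ _ hu.ne'
    · rw [map_smul, smul_eq_mul] at hux
      rwa [smul_apply, smul_eq_mul, div_mul_eq_mul_div, one_lt_div hu]
  choose! F hF using hsep
  have hcomp : IsCompact (frontier K) :=
    hK.1.of_isClosed_subset isClosed_frontier hK.1.isClosed.frontier_subset
  obtain ⟨s, hs, hcover⟩ := hcomp.elim_nhds_subcover (fun x => {y | 1 < F x y}) fun x hx =>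
    (isOpen_lt continuous_const (F x).continuous).mem_nhds (hF x hx).2
  classical
  refine ⟨s.image F, ?_, fun x hx => ?_⟩
  · simp only [Finset.mem_image, forall_exists_index, and_imp, forall_apply_eq_imp_iff₂]
    exact fun a ha => (hF a (hs a ha)).1
  · obtain ⟨y, hy, hyK⟩ : ∃ y ∈ segment ℝ 0 x, y ∈ frontier K := by
      by_contra! h
      obtain ⟨y, -, hy, hyK⟩ := (convex_segment (0 : E n) x).isPreconnected (interior K) Kᶜ
        isOpen_interior hK.1.isClosed.isOpen_compl
        (fun y hy => or_iff_not_imp_right.2 fun hyK => by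
          by_contra hyi
          exact h y hy ⟨subset_closure (not_not.1 hyK), hyi⟩)
        ⟨0, left_mem_segment ℝ _ _, h0⟩ ⟨x, right_mem_segment ℝ _ _, hx⟩
      exact hyK (interior_subset hy)
    obtain ⟨a, ha, hay⟩ := Set.mem_iUnion₂.1 (hcover hyK)
    refine ⟨F a, Finset.mem_image_of_mem F ha, ?_⟩
    rw [segment_eq_image] at hy
    obtain ⟨θ, hθ, rfl⟩ := hy
    simp only [smul_zero, zero_add, Set.mem_ofPred_eq, map_smul, smul_eq_mul] at hay
    nlinarith [hθ.1, hθ.2]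

/-- A centered convex body contains one with smooth radial function that contains a homothetic copy
of it, with ratio as close to `1` as desired. -/
theorem exists_smooth_convexBody_subset {n : ℕ} {K : Set (E n)} (hK : IsConvexBody K)
    (hc : IsCentered K) {r : ℝ} (hr : 1 < r) :
    ∃ L : Set (E n), IsConvexBody L ∧ IsCentered L ∧ SmoothOnSphere (radialFn L) ∧
      L ⊆ K ∧ ∀ x ∈ K, (r ^ 2)⁻¹ • x ∈ L := by
  obtain ⟨t, htK, ht⟩ := exists_finset_separating hK hc hr
  have hr0 : 0 < r := one_pos.trans hr
  obtain ⟨k, hk⟩ := pow_unbounded_of_one_lt (t.card : ℝ) hr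
  set m := k + 1 with hm
  have hm0 : m ≠ 0 := k.succ_ne_zero
  have hcard : (t.card : ℝ) ≤ r ^ (2 * m) :=
    hk.le.trans (pow_le_pow_right₀ hr.le (by omega))
  have hnn : ∀ x : E n, ∀ f ∈ t, 0 ≤ f x ^ (2 * m) := fun x f _ => (even_two_mul m).pow_nonneg _
  have hout : ∀ x ∉ K, 1 < ∑ f ∈ t, f x ^ (2 * m) := fun x hx => by
    obtain ⟨f, hf, hfx⟩ := ht x hx
    exact (one_lt_pow₀ hfx (by omega)).trans_le (Finset.single_le_sum (hnn x) hf)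
  have hsub : powerSumBody t m ⊆ K := fun x hx => by
    by_contra h
    exact (hout x h).not_ge hx
  have hpos : ∀ x : E n, x ≠ 0 → 0 < ∑ f ∈ t, f x ^ (2 * m) := fun x hx => by
    obtain ⟨R, hR⟩ := hK.1.isBounded.exists_norm_le
    have hx' : 0 < ‖x‖ := norm_pos_iff.2 hx
    have hbig : ((|R| + 1) / ‖x‖) • x ∉ K := fun h => by
      have := hR _ h
      rw [norm_smul, Real.norm_of_nonneg (by positivity), div_mul_cancel₀ _ hx'.ne'] at this
      linarith [le_abs_self R]
    refine (Finset.sum_nonneg (hnn x)).lt_of_ne fun h => ?_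
    have := hout _ hbig
    simp only [map_smul, smul_eq_mul, mul_pow, ← Finset.mul_sum, ← h] at this
    linarith
  refine ⟨powerSumBody t m, ⟨hK.1.of_isClosed_subset (isClosed_powerSumBody t m) hsub,
    convex_powerSumBody t m, 0, zero_mem_interior_powerSumBody t hm0⟩,
    isCentered_powerSumBody t m, smoothOnSphere_radialFn_powerSumBody hm0 hpos, hsub,
    fun x hx => ?_⟩
  have hterm : ∀ f ∈ t, f ((r ^ 2)⁻¹ • x) ^ (2 * m) ≤ (r ^ (2 * m))⁻¹ := fun f hf => by
    rw [map_smul, smul_eq_mul, ← (even_two_mul m).pow_abs, ← inv_pow r (2 * m), abs_mul,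
      abs_of_pos (inv_pos.2 (pow_pos hr0 2))]
    refine pow_le_pow_left₀ (by positivity) ?_ _
    calc (r ^ 2)⁻¹ * |f x| ≤ (r ^ 2)⁻¹ * r := by gcongr; exact htK f hf x hx
      _ = r⁻¹ := by field_simp
  calc ∑ f ∈ t, f ((r ^ 2)⁻¹ • x) ^ (2 * m) ≤ t.card • (r ^ (2 * m))⁻¹ :=
        Finset.sum_le_card_nsmul _ _ _ hterm
    _ ≤ 1 := by
        rw [nsmul_eq_mul, ← div_eq_mul_inv]
        exact div_le_one_of_le₀ hcard (by positivity)

/-- Approximation reduction: if the Busemann–Petty implication in `ℝ³` holds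
whenever the first body has `C^∞` radial function, then it holds for all
centered convex bodies. -/
theorem busemann_petty_smooth_reduction
    (hsmooth : ∀ K₁ K₂ : Set (E 3),
      IsConvexBody K₁ → IsCentered K₁ → SmoothOnSphere (radialFn K₁) →
      IsConvexBody K₂ → IsCentered K₂ →
      (∀ u ∈ sphere (0 : E 3) 1,
        μH[2] (K₁ ∩ hyperplane u) ≤ μH[2] (K₂ ∩ hyperplane u)) →
      μH[3] K₁ ≤ μH[3] K₂) :
    ∀ K₁ K₂ : Set (E 3),
      IsConvexBody K₁ → IsCentered K₁ → IsConvexBody K₂ → IsCentered K₂ →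
      (∀ u ∈ sphere (0 : E 3) 1,
        μH[2] (K₁ ∩ hyperplane u) ≤ μH[2] (K₂ ∩ hyperplane u)) →
      μH[3] K₁ ≤ μH[3] K₂ := by
  intro K₁ K₂ hK₁ hc₁ hK₂ hc₂ hsec
  have hbound : ∀ r : ℝ, 1 < r → μH[3] K₁ ≤ ENNReal.ofReal ((r ^ 2) ^ 3) * μH[3] K₂ := by
    intro r hr
    have hr2 : 0 < r ^ 2 := by positivity
    obtain ⟨L, hL, hcL, hsL, hLK, hKL⟩ := exists_smooth_convexBody_subset hK₁ hc₁ hr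
    have hle : μH[3] L ≤ μH[3] K₂ := hsmooth L K₂ hL hcL hsL hK₂ hc₂ fun u hu =>
      (measure_mono (Set.inter_subset_inter_left _ hLK)).trans (hsec u hu)
    have hK₁L : K₁ ⊆ (fun x => r ^ 2 • x) '' L := fun x hx =>
      ⟨_, hKL x hx, smul_inv_smul₀ hr2.ne' x⟩
    calc μH[3] K₁ ≤ μH[3] ((fun x => r ^ 2 • x) '' L) := measure_mono hK₁L
      _ = ENNReal.ofReal ((r ^ 2) ^ 3) * μH[3] L := by
        rw [Set.image_smul, Measure.hausdorffMeasure_smul₀ (by norm_num) hr2.ne',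
          ENNReal.smul_def, smul_eq_mul, ← Real.rpow_natCast]
        congr 1
        rw [← ENNReal.ofReal_coe_nnreal]
        simp
      _ ≤ _ := by gcongr
  have hlim : Filter.Tendsto (fun r : ℝ => ENNReal.ofReal ((r ^ 2) ^ 3) * μH[3] K₂)
      (nhdsWithin 1 (Set.Ioi 1)) (nhds (μH[3] K₂)) := by
    have hcont : Continuous fun r : ℝ => ENNReal.ofReal ((r ^ 2) ^ 3) :=
      ENNReal.continuous_ofReal.comp (by fun_prop)
    have h := ENNReal.Tendsto.mul_const (b := μH[3] K₂) (hcont.tendsto 1) (Or.inl (by simp))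
    simpa using h.mono_left (nhdsWithin_le_nhds (s := Set.Ioi 1))
  exact ge_of_tendsto hlim (eventually_mem_nhdsWithin.mono hbound)
end
end

section
/- (Invertibility of the spherical Radon transform on smooth even functions on S².) For every even C^∞ function f on S² there exists a unique even C^∞ function g on S² such that Rg = f, i.e., ∫_{S² ∩ u^⊥} g(v) dλ₁(v) = f(u) for all u ∈ S². -/
open MeasureTheory Metric
open scoped RealInnerProductSpace ENNReal

noncomputable section

theorem intervalIntegral_swap_of_continuous {F : ℝ → ℝ → ℝ}
    (hF : Continuous (Function.uncurry F)) (a b c d : ℝ) :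
    ∫ x in a..b, ∫ y in c..d, F x y = ∫ y in c..d, ∫ x in a..b, F x y := by
  apply intervalIntegral_intervalIntegral_swap
  exact (hF.continuousOn.integrableOn_compact
    (isCompact_uIcc.prod isCompact_uIcc)).mono_set
    (Set.prod_mono Set.uIoc_subset_uIcc Set.uIoc_subset_uIcc)

theorem integral_sin_pow_mul_integral_cos_pow (n : ℕ) :
    (∫ α in (0 : ℝ)..Real.pi, Real.sin α ^ (n + 1)) * ∫ φ in (0 : ℝ)..2 * Real.pi, Real.cos φ ^ n
      = 2 * Real.pi * ∫ x in (-1 : ℝ)..1, x ^ n := by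
  induction n using Nat.twoStepInduction with
  | zero => simp; ring
  | one => simp
  | more n ih _ =>
    rw [integral_pow] at ih ⊢
    rw [show n + 2 + 1 = (n + 1) + 2 by ring, integral_sin_pow, integral_cos_pow]
    simp only [Real.sin_zero, Real.sin_pi, Real.sin_two_pi, Real.cos_zero] at ih ⊢
    have h1 : (n : ℝ) + 1 ≠ 0 := by positivity
    have h2 : (n : ℝ) + 2 ≠ 0 := by positivity
    have h3 : (n : ℝ) + 3 ≠ 0 := by positivity
    have h4 : (n : ℝ) + 1 + 2 ≠ 0 := by positivity
    have h5 : (n : ℝ) + 2 + 1 ≠ 0 := by positivity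
    generalize (∫ α in (0 : ℝ)..Real.pi, Real.sin α ^ (n + 1)) = P at *
    generalize (∫ α in (0 : ℝ)..2 * Real.pi, Real.cos α ^ n) = Q at *
    have e : ((-1 : ℝ)) ^ (n + 1 + 2) = (-1) ^ (n + 1) := by rw [pow_add]; norm_num
    rw [e]
    push_cast
    rw [eq_comm, mul_div_assoc', eq_comm, eq_div_iff h1] at ih
    simp only [ne_eq, Nat.add_eq_zero_iff, one_ne_zero, and_false, not_false_eq_true, zero_pow,
      zero_mul, mul_zero, sub_zero, zero_div, zero_add]
    field_simp
    linear_combination ((n : ℝ) + 3) * (n + 2) * ih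

theorem archimedes_polynomial (p : Polynomial ℝ) :
    ∫ α in (0 : ℝ)..Real.pi, ∫ φ in (0 : ℝ)..2 * Real.pi,
        p.eval (Real.sin α * Real.cos φ) * Real.sin α
      = 2 * Real.pi * ∫ x in (-1 : ℝ)..1, p.eval x := by
  induction p using Polynomial.induction_on' with
  | add p q hp hq =>
    have hc (p : Polynomial ℝ) : Continuous fun z : ℝ × ℝ =>
      p.eval (Real.sin z.1 * Real.cos z.2) * Real.sin z.1 := by fun_prop
    have hi (p : Polynomial ℝ) (α : ℝ) : IntervalIntegrable (fun φ =>
      p.eval (Real.sin α * Real.cos φ) * Real.sin α) volume 0 (2 * Real.pi) :=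
      Continuous.intervalIntegrable (by fun_prop) _ _
    have hj (p : Polynomial ℝ) : IntervalIntegrable (fun α => ∫ φ in (0 : ℝ)..2 * Real.pi,
      p.eval (Real.sin α * Real.cos φ) * Real.sin α) volume 0 Real.pi :=
      Continuous.intervalIntegrable
        (intervalIntegral.continuous_parametric_intervalIntegral_of_continuous' (hc p) _ _) _ _
    simp only [Polynomial.eval_add, add_mul]
    simp_rw [fun α => intervalIntegral.integral_add (hi p α) (hi q α)]
    rw [intervalIntegral.integral_add (hj p) (hj q),
      intervalIntegral.integral_add (p.continuous.intervalIntegrable _ _)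
        (q.continuous.intervalIntegrable _ _), hp, hq, mul_add]
  | monomial n a =>
    have e (α φ : ℝ) : (Polynomial.monomial n a).eval (Real.sin α * Real.cos φ) * Real.sin α
      = (a * Real.sin α ^ (n + 1)) * Real.cos φ ^ n := by
      rw [Polynomial.eval_monomial]; ring
    simp only [e]
    simp only [Polynomial.eval_monomial, intervalIntegral.integral_const_mul,
      intervalIntegral.integral_mul_const]
    linear_combination a * integral_sin_pow_mul_integral_cos_pow n

/-- Archimedes' hat-box theorem: the coordinate along a fixed equatorial axis pushes the surface
measure of the unit sphere to a multiple of Lebesgue measure. -/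
theorem integral_sphere_coordinate {F : ℝ → ℝ} (hF : Continuous F) :
    ∫ α in (0 : ℝ)..Real.pi, ∫ φ in (0 : ℝ)..2 * Real.pi,
        F (Real.sin α * Real.cos φ) * Real.sin α
      = 2 * Real.pi * ∫ x in (-1 : ℝ)..1, F x := by
  have hpi := Real.pi_pos
  have hc {F : ℝ → ℝ} (hF : Continuous F) : Continuous fun z : ℝ × ℝ =>
    F (Real.sin z.1 * Real.cos z.2) * Real.sin z.1 := by fun_prop
  have hi {F : ℝ → ℝ} (hF : Continuous F) (α : ℝ) : IntervalIntegrable (fun φ =>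
    F (Real.sin α * Real.cos φ) * Real.sin α) volume 0 (2 * Real.pi) :=
    Continuous.intervalIntegrable (by fun_prop) _ _
  have hj {F : ℝ → ℝ} (hF : Continuous F) : IntervalIntegrable (fun α =>
    ∫ φ in (0 : ℝ)..2 * Real.pi,
      F (Real.sin α * Real.cos φ) * Real.sin α) volume 0 Real.pi :=
    Continuous.intervalIntegrable
      (intervalIntegral.continuous_parametric_intervalIntegral_of_continuous' (hc hF) _ _) _ _
  refine eq_of_forall_dist_le fun ε hε => ?_
  obtain ⟨p, hp⟩ := exists_polynomial_near_of_continuousOn (-1) 1 F hF.continuousOn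
    (ε / (2 * Real.pi * Real.pi + 4 * Real.pi)) (by positivity)
  set δ := ε / (2 * Real.pi * Real.pi + 4 * Real.pi) with hδ
  have hδε : δ * (2 * Real.pi) * Real.pi + 2 * Real.pi * (δ * 2) = ε := by
    rw [hδ]; field_simp; ring
  have hδ0 : 0 < δ := by positivity
  have hP := p.continuous
  have hsc (α φ : ℝ) : Real.sin α * Real.cos φ ∈ Set.Icc (-1 : ℝ) 1 := by
    rw [Set.mem_Icc, ← abs_le, abs_mul]
    exact mul_le_one₀ (Real.abs_sin_le_one α) (abs_nonneg _) (Real.abs_cos_le_one φ)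
  have h1 : |(∫ α in (0 : ℝ)..Real.pi, ∫ φ in (0 : ℝ)..2 * Real.pi,
        F (Real.sin α * Real.cos φ) * Real.sin α) - ∫ α in (0 : ℝ)..Real.pi,
        ∫ φ in (0 : ℝ)..2 * Real.pi, p.eval (Real.sin α * Real.cos φ) * Real.sin α|
      ≤ δ * (2 * Real.pi) * Real.pi := by
    rw [← intervalIntegral.integral_sub (hj hF) (hj hP), ← Real.norm_eq_abs]
    refine (intervalIntegral.norm_integral_le_of_norm_le_const (C := δ * (2 * Real.pi))
      fun α _ => ?_).trans_eq (by rw [sub_zero, abs_of_pos hpi])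
    rw [← intervalIntegral.integral_sub (hi hF α) (hi hP α)]
    refine (intervalIntegral.norm_integral_le_of_norm_le_const (C := δ)
      fun φ _ => ?_).trans_eq (by rw [sub_zero, abs_of_pos (by positivity)])
    rw [← sub_mul, Real.norm_eq_abs, abs_mul, abs_sub_comm]
    exact (mul_le_of_le_one_right (abs_nonneg _) (Real.abs_sin_le_one α)).trans
      (hp _ (hsc α φ)).le
  have h2 : |(∫ x in (-1 : ℝ)..1, p.eval x) - ∫ x in (-1 : ℝ)..1, F x| ≤ δ * 2 := by
    rw [← intervalIntegral.integral_sub (hP.intervalIntegrable _ _) (hF.intervalIntegrable _ _),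
      ← Real.norm_eq_abs]
    refine (intervalIntegral.norm_integral_le_of_norm_le_const (C := δ)
      fun x hx => ?_).trans_eq (by norm_num)
    rw [Set.uIoc_of_le (by norm_num)] at hx
    exact (hp x ⟨hx.1.le, hx.2⟩).le
  rw [Real.dist_eq, ← hδε]
  have h3 := archimedes_polynomial p
  calc _ = |((∫ α in (0 : ℝ)..Real.pi, ∫ φ in (0 : ℝ)..2 * Real.pi,
        F (Real.sin α * Real.cos φ) * Real.sin α) - ∫ α in (0 : ℝ)..Real.pi,
        ∫ φ in (0 : ℝ)..2 * Real.pi, p.eval (Real.sin α * Real.cos φ) * Real.sin α)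
        + 2 * Real.pi * ((∫ x in (-1 : ℝ)..1, p.eval x) - ∫ x in (-1 : ℝ)..1, F x)| := by
        rw [h3]; ring_nf
    _ ≤ _ := by
      refine (abs_add_le _ _).trans (add_le_add h1 ?_)
      rw [abs_mul, abs_of_pos (by positivity : 0 < 2 * Real.pi)]
      gcongr

theorem hasFDerivAt_intervalIntegral_smul {X Y : Type*} [NormedAddCommGroup X] [NormedSpace ℝ X]
    [FiniteDimensional ℝ X] [NormedAddCommGroup Y] [NormedSpace ℝ Y]
    {Φ : X × ℝ → Y} {U : Set X} (hU : IsOpen U) (hΦ : ContDiffOn ℝ 1 Φ (U ×ˢ Set.univ))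
    {w : ℝ → ℝ} (hw : Continuous w) (a b : ℝ) {x : X} (hx : x ∈ U) :
    HasFDerivAt (fun x => ∫ t in a..b, w t • Φ (x, t))
      (∫ t in a..b, w t • (fderiv ℝ Φ (x, t)).comp (ContinuousLinearMap.inl ℝ X ℝ)) x := by
  have : ProperSpace X := FiniteDimensional.proper ℝ X
  have hV : IsOpen (U ×ˢ (Set.univ : Set ℝ)) := hU.prod isOpen_univ
  have hd : ContinuousOn (fderiv ℝ Φ) (U ×ˢ Set.univ) := hΦ.continuousOn_fderiv_of_isOpen hV le_rfl
  have hd' : ContinuousOn (fun z : X × ℝ => w z.2 •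
      (fderiv ℝ Φ z).comp (ContinuousLinearMap.inl ℝ X ℝ)) (U ×ˢ Set.univ) :=
    (hw.comp continuous_snd).continuousOn.smul (hd.clm_comp continuousOn_const)
  obtain ⟨r, hr, hrU⟩ := Metric.nhds_basis_closedBall.mem_iff.1 (hU.mem_nhds hx)
  obtain ⟨C, hC⟩ := ((isCompact_closedBall x r).prod (isCompact_uIcc (a := a) (b := b))
    ).exists_bound_of_continuousOn (hd'.mono (Set.prod_mono hrU (Set.subset_univ _)))
  have hsec {y : X} (hy : y ∈ U) : Continuous fun t => Φ (y, t) :=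
    hΦ.continuousOn.comp_continuous (by fun_prop) fun t => ⟨hy, Set.mem_univ _⟩
  refine intervalIntegral.hasFDerivAt_integral_of_dominated_of_fderiv_le (bound := fun _ => C)
    (F' := fun x t => w t • (fderiv ℝ Φ (x, t)).comp (ContinuousLinearMap.inl ℝ X ℝ))
    (Metric.closedBall_mem_nhds x hr) ?_ ?_ ?_ ?_ ?_ ?_
  · filter_upwards [hU.mem_nhds hx] with y hy
    exact (hw.smul (hsec hy)).aestronglyMeasurable
  · exact (hw.smul (hsec hx)).intervalIntegrable _ _
  · exact (hd'.comp_continuous (f := fun t : ℝ => (x, t)) (by fun_prop)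
      fun t => ⟨hx, Set.mem_univ _⟩).aestronglyMeasurable
  · exact .of_forall fun t ht y hy => hC (y, t) ⟨hy, Set.uIoc_subset_uIcc ht⟩
  · exact intervalIntegrable_const
  · refine .of_forall fun t _ y hy => HasFDerivAt.const_smul ?_ _
    have h1 : HasFDerivAt Φ (fderiv ℝ Φ (y, t)) (y, t) :=
      ((hΦ.differentiableOn one_ne_zero).differentiableAt
        (hV.mem_nhds ⟨hrU hy, Set.mem_univ _⟩)).hasFDerivAt
    exact h1.comp y (hasFDerivAt_prodMk_left y t)

theorem contDiffOn_intervalIntegral_smul {X : Type} [NormedAddCommGroup X] [NormedSpace ℝ X]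
    [FiniteDimensional ℝ X] {Y : Type} [NormedAddCommGroup Y] [NormedSpace ℝ Y]
    {Φ : X × ℝ → Y} {U : Set X} (hU : IsOpen U)
    (hΦ : ContDiffOn ℝ (⊤ : ℕ∞) Φ (U ×ˢ Set.univ))
    {w : ℝ → ℝ} (hw : Continuous w) (a b : ℝ) :
    ContDiffOn ℝ (⊤ : ℕ∞) (fun x => ∫ t in a..b, w t • Φ (x, t)) U := by
  have hV : IsOpen (U ×ˢ (Set.univ : Set ℝ)) := hU.prod isOpen_univ
  refine contDiffOn_infty.2 fun n => ?_
  induction n generalizing Y with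
  | zero =>
    refine contDiffOn_zero.2 fun x hx => ?_
    exact (hasFDerivAt_intervalIntegral_smul hU (hΦ.of_le (by exact_mod_cast le_top)) hw a b hx
      ).continuousAt.continuousWithinAt
  | succ n ih =>
    have key {x : X} (hx : x ∈ U) := hasFDerivAt_intervalIntegral_smul hU
      (hΦ.of_le (by exact_mod_cast le_top)) hw a b hx
    push_cast
    refine (contDiffOn_succ_iff_fderiv_of_isOpen hU).2
      ⟨fun x hx => (key hx).differentiableAt.differentiableWithinAt, by simp, ?_⟩
    refine (ih (Φ := fun z => (fderiv ℝ Φ z).comp (ContinuousLinearMap.inl ℝ X ℝ)) ?_).congr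
      fun x hx => (key hx).fderiv
    exact (hΦ.fderiv_of_isOpen hV (by simp)).clm_comp contDiffOn_const

theorem hasDerivAt_intervalIntegral_of_continuous {G G' : ℝ → ℝ → ℝ}
    (hG : Continuous (Function.uncurry G)) (hG' : Continuous (Function.uncurry G'))
    (h : ∀ t x, HasDerivAt (fun t => G t x) (G' t x) t) (a b t : ℝ) :
    HasDerivAt (fun t => ∫ x in a..b, G t x) (∫ x in a..b, G' t x) t := by
  obtain ⟨C, hC⟩ := ((isCompact_closedBall t 1).prod (isCompact_uIcc (a := a) (b := b))
    ).exists_bound_of_continuousOn hG'.continuousOn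
  refine (intervalIntegral.hasDerivAt_integral_of_dominated_loc_of_deriv_le (bound := fun _ => C)
    (Metric.closedBall_mem_nhds t one_pos) ?_ ?_ ?_ ?_ ?_ ?_).2
  · exact .of_forall fun s => (hG.comp (Continuous.prodMk_right s)).aestronglyMeasurable
  · exact (hG.comp (Continuous.prodMk_right t)).intervalIntegrable _ _
  · exact (hG'.comp (Continuous.prodMk_right t)).aestronglyMeasurable
  · exact .of_forall fun x hx s hs => hC (s, x) ⟨hs, Set.uIoc_subset_uIcc hx⟩
  · exact intervalIntegrable_const
  · exact .of_forall fun x _ s _ => h s x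

theorem exists_contDiffOn_hasDerivAt_mul_of_even {X : Type} [NormedAddCommGroup X] [NormedSpace ℝ X]
    [FiniteDimensional ℝ X] {Φ : X × ℝ → ℝ} {U : Set X} (hU : IsOpen U)
    (hΦ : ContDiffOn ℝ (⊤ : ℕ∞) Φ (U ×ˢ Set.univ))
    (heven : ∀ x ∈ U, ∀ t, Φ (x, -t) = Φ (x, t)) :
    ∃ S : X × ℝ → ℝ, ContDiffOn ℝ (⊤ : ℕ∞) S (U ×ˢ Set.univ) ∧
      ∀ x ∈ U, ∀ t, HasDerivAt (fun t => Φ (x, t)) (t * S (x, t)) t := by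
  have hV : IsOpen (U ×ˢ (Set.univ : Set ℝ)) := hU.prod isOpen_univ
  have hpartial {Ψ : X × ℝ → ℝ} (hΨ : ContDiffOn ℝ (⊤ : ℕ∞) Ψ (U ×ˢ Set.univ)) :
      ContDiffOn ℝ (⊤ : ℕ∞) (fun z => fderiv ℝ Ψ z (0, 1)) (U ×ˢ Set.univ) ∧
      ∀ x ∈ U, ∀ t, HasDerivAt (fun t => Ψ (x, t)) (fderiv ℝ Ψ (x, t) (0, 1)) t := by
    refine ⟨(hΨ.fderiv_of_isOpen hV (by simp)).clm_apply contDiffOn_const, fun x hx t => ?_⟩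
    have h1 : HasFDerivAt Ψ (fderiv ℝ Ψ (x, t)) (x, t) :=
      ((hΨ.differentiableOn (by simp)).differentiableAt
        (hV.mem_nhds ⟨hx, Set.mem_univ _⟩)).hasFDerivAt
    exact h1.comp_hasDerivAt t ((hasDerivAt_const t x).prodMk (hasDerivAt_id t))
  obtain ⟨h1, h1'⟩ := hpartial hΦ
  obtain ⟨h2, h2'⟩ := hpartial h1
  set D1 := fun z => fderiv ℝ Φ z (0, 1)
  set D2 := fun z => fderiv ℝ D1 z (0, 1)
  refine ⟨fun z => ∫ s in (0 : ℝ)..1, (1 : ℝ) • D2 (z.1, s * z.2), ?_, fun x hx t => ?_⟩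
  · refine contDiffOn_intervalIntegral_smul (Φ := fun y : (X × ℝ) × ℝ => D2 (y.1.1, y.2 * y.1.2))
      hV (h2.comp (by fun_prop) ?_) continuous_const 0 1
    rintro ⟨⟨x, t⟩, s⟩ ⟨⟨hx, -⟩, -⟩
    exact ⟨hx, Set.mem_univ _⟩
  · have h0 : D1 (x, 0) = 0 := by
      have e1 := h1' x hx 0
      have e2 : HasDerivAt (fun t => Φ (x, -t)) (-D1 (x, 0)) 0 := by
        have e3 : HasDerivAt (fun t => Φ (x, t)) (D1 (x, 0)) (-0) := by simpa using e1
        simpa [Function.comp_def] using e3.scomp (0 : ℝ) (hasDerivAt_neg (0 : ℝ))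
      simp only [heven x hx] at e2
      linarith [e1.unique e2]
    have hc : Continuous fun s : ℝ => D2 (x, s * t) :=
      h2.continuousOn.comp_continuous (by fun_prop) fun t => ⟨hx, Set.mem_univ _⟩
    have hftc : ∫ s in (0 : ℝ)..1, t * D2 (x, s * t) = D1 (x, 1 * t) - D1 (x, 0 * t) := by
      refine intervalIntegral.integral_eq_sub_of_hasDerivAt (f := fun s => D1 (x, s * t))
        (fun s _ => ?_) ((continuous_const.mul hc).intervalIntegrable _ _)
      have := (h2' x hx (s * t)).scomp s ((hasDerivAt_id s).mul_const t)
      simpa [Function.comp_def] using this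
    rw [one_mul, zero_mul, h0, sub_zero, intervalIntegral.integral_const_mul] at hftc
    simp only [one_smul]
    rw [hftc]
    exact h1' x hx t

/-- A continuous function agreeing with `t / sin t` on `(0, π / 2]`. -/
def divSin (t : ℝ) : ℝ := (max (Real.sinc t) (1 / 2))⁻¹

theorem continuous_divSin : Continuous divSin :=
  (Real.continuous_sinc.max continuous_const).inv₀ fun t =>
    (lt_of_lt_of_le (by norm_num) (le_max_right _ _)).ne'

theorem sin_mul_divSin {t : ℝ} (h0 : 0 < t) (h1 : t ≤ Real.pi / 2) :
    Real.sin t * divSin t = t := by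
  have hs : 2 / Real.pi * t ≤ Real.sin t := Real.mul_le_sin h0.le h1
  have h2 : 1 / 2 ≤ Real.sinc t := by
    rw [Real.sinc_of_ne_zero h0.ne', le_div_iff₀ h0]
    refine le_trans ?_ hs
    gcongr ?_ * t
    rw [div_le_div_iff₀ two_pos Real.pi_pos]
    linarith [Real.pi_le_four]
  have hs0 : 0 < Real.sin t := Real.sin_pos_of_pos_of_lt_pi h0 (by linarith [Real.pi_pos])
  rw [divSin, max_eq_left h2, Real.sinc_of_ne_zero h0.ne']
  field_simp

/-- The integral of `deriv m / sin` over `[0, π / 2]`. -/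
def sinQuotientIntegral (m : ℝ → ℝ) : ℝ := ∫ t in (0 : ℝ)..Real.pi / 2, deriv m t / Real.sin t

theorem sinQuotientIntegral_eq {m S : ℝ → ℝ} (h : ∀ t, HasDerivAt m (t * S t) t) :
    sinQuotientIntegral m = ∫ t in (0 : ℝ)..Real.pi / 2, divSin t * S t := by
  refine intervalIntegral.integral_congr_ae (.of_forall fun t ht => ?_)
  rw [Set.uIoc_of_le (by positivity)] at ht
  have hs0 : 0 < Real.sin t :=
    Real.sin_pos_of_pos_of_lt_pi ht.1 (by linarith [Real.pi_pos, ht.2])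
  rw [(h t).deriv, div_eq_iff hs0.ne']
  nth_rewrite 1 [← sin_mul_divSin ht.1 ht.2]
  ring

theorem contDiffOn_sinQuotientIntegral {X : Type} [NormedAddCommGroup X] [NormedSpace ℝ X]
    [FiniteDimensional ℝ X] {Φ : X × ℝ → ℝ} {U : Set X} (hU : IsOpen U)
    (hΦ : ContDiffOn ℝ (⊤ : ℕ∞) Φ (U ×ˢ Set.univ))
    (heven : ∀ x ∈ U, ∀ t, Φ (x, -t) = Φ (x, t)) :
    ContDiffOn ℝ (⊤ : ℕ∞) (fun x => sinQuotientIntegral fun t => Φ (x, t)) U := by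
  obtain ⟨S, hS, hd⟩ := exists_contDiffOn_hasDerivAt_mul_of_even hU hΦ heven
  exact (contDiffOn_intervalIntegral_smul hU hS continuous_divSin 0 (Real.pi / 2)).congr
    fun x hx => sinQuotientIntegral_eq (S := fun t => S (x, t)) (hd x hx)

theorem exists_hasDerivAt_integral_sinQuotientIntegral {Φ : ℝ × ℝ → ℝ}
    (hΦ : ContDiff ℝ (⊤ : ℕ∞) Φ) (heven : ∀ x t, Φ (x, -t) = Φ (x, t)) (a b : ℝ) :
    ∃ S : ℝ → ℝ, Continuous S ∧
      (∀ t ∈ Set.Ioo 0 (Real.pi / 2),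
        HasDerivAt (fun t => ∫ x in a..b, Φ (x, t)) (Real.sin t * S t) t) ∧
      ∫ x in a..b, sinQuotientIntegral (fun t => Φ (x, t)) =
        ∫ t in (0 : ℝ)..Real.pi / 2, S t := by
  obtain ⟨S, hS, hd⟩ := exists_contDiffOn_hasDerivAt_mul_of_even isOpen_univ
    (by simpa using hΦ.contDiffOn) fun x _ => heven x
  have hSc : Continuous S := by simpa [continuousOn_univ] using hS.continuousOn
  refine ⟨fun t => divSin t * ∫ x in a..b, S (x, t), ?_, fun t ht => ?_, ?_⟩
  · exact continuous_divSin.mul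
      (intervalIntegral.continuous_parametric_intervalIntegral_of_continuous'
      (f := fun t x => S (x, t)) (hSc.comp continuous_swap) a b)
  · rw [← mul_assoc, sin_mul_divSin ht.1 ht.2.le, ← intervalIntegral.integral_const_mul]
    exact hasDerivAt_intervalIntegral_of_continuous (G := fun t x => Φ (x, t))
      (G' := fun t x => t * S (x, t)) (hΦ.continuous.comp continuous_swap)
      (continuous_fst.mul (hSc.comp continuous_swap)) (fun t x => hd x (Set.mem_univ _) t) a b t
  · simp_rw [fun x => sinQuotientIntegral_eq (S := fun t => S (x, t)) (hd x (Set.mem_univ _)),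
      ← intervalIntegral.integral_const_mul]
    exact intervalIntegral_swap_of_continuous (F := fun x t => divSin t * S (x, t))
      ((continuous_divSin.comp continuous_snd).mul hSc) _ _ _ _

theorem integral_comp_sin_zero_pi {h : ℝ → ℝ} (hh : Continuous h) :
    ∫ α in (0 : ℝ)..Real.pi, h (Real.sin α) = 2 * ∫ α in (0 : ℝ)..Real.pi / 2, h (Real.cos α) := by
  have hc : Continuous fun α => h (Real.sin α) := by fun_prop
  rw [← intervalIntegral.integral_add_adjacent_intervals (hc.intervalIntegrable 0 (Real.pi / 2))
    (hc.intervalIntegrable _ _), two_mul]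
  have h1 : ∫ α in (0 : ℝ)..Real.pi / 2, h (Real.cos α) =
      ∫ α in (0 : ℝ)..Real.pi / 2, h (Real.sin α) := by
    have := intervalIntegral.integral_comp_sub_left (a := 0) (b := Real.pi / 2)
      (fun α => h (Real.sin α)) (Real.pi / 2)
    simpa [Real.sin_pi_div_two_sub] using this
  have h2 : ∫ α in (0 : ℝ)..Real.pi / 2, h (Real.sin α) =
      ∫ α in (Real.pi / 2)..Real.pi, h (Real.sin α) := by
    have := intervalIntegral.integral_comp_sub_left (a := 0) (b := Real.pi / 2)
      (fun α => h (Real.sin α)) Real.pi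
    simpa [Real.sin_pi_sub, sub_half] using this
  rw [h1, ← h2]

/-- Schlömilch's integral equation: `F 1` is recovered from the circular averages of `F`. -/
theorem schlomilch_inversion {F S : ℝ → ℝ} (hF : Continuous F) (heven : ∀ x, F (-x) = F x)
    (hS : Continuous S)
    (hB : ∀ t ∈ Set.Ioo 0 (Real.pi / 2), HasDerivAt
      (fun t => ∫ φ in (0 : ℝ)..2 * Real.pi, F (Real.cos t * Real.cos φ)) (Real.sin t * S t) t) :
    2 * Real.pi * F 0 - ∫ t in (0 : ℝ)..Real.pi / 2, S t = 2 * Real.pi * F 1 := by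
  set H : ℝ → ℝ := fun ρ => ∫ φ in (0 : ℝ)..2 * Real.pi, F (ρ * Real.cos φ) with hH
  set h : ℝ → ℝ := fun ρ => -S (Real.arccos ρ) with hh
  have hHc : Continuous H := intervalIntegral.continuous_parametric_intervalIntegral_of_continuous'
    (f := fun ρ φ => F (ρ * Real.cos φ)) (by fun_prop) _ _
  have hhc : Continuous h := (hS.comp Real.continuous_arccos).neg
  set K : ℝ → ℝ := fun ρ => H 0 + ∫ x in (0 : ℝ)..ρ, h x with hK
  have hK' (ρ : ℝ) : HasDerivAt K (h ρ) ρ :=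
    (intervalIntegral.integral_hasDerivAt_right (hhc.intervalIntegrable _ _)
      (hhc.stronglyMeasurableAtFilter _ _) hhc.continuousAt).const_add _
  have hKc : Continuous K := continuous_iff_continuousAt.2 fun ρ => (hK' ρ).continuousAt
  have hHd (ρ : ℝ) (hρ : ρ ∈ Set.Ioo (0 : ℝ) 1) : HasDerivAt H (h ρ) ρ := by
    have h1 := hB (Real.arccos ρ) ⟨Real.arccos_pos.2 hρ.2, Real.arccos_lt_pi_div_two.2 hρ.1⟩
    have h2 := h1.comp ρ (Real.hasDerivAt_arccos (by linarith [hρ.1]) hρ.2.ne)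
    have h3 : Real.sin (Real.arccos ρ) * S (Real.arccos ρ) * -(1 / √(1 - ρ ^ 2)) = h ρ := by
      have : 0 < √(1 - ρ ^ 2) := Real.sqrt_pos.2 (by nlinarith [hρ.1, hρ.2])
      rw [Real.sin_arccos, hh]
      field_simp
    rw [h3] at h2
    refine h2.congr_of_eventuallyEq ?_
    filter_upwards [Ioo_mem_nhds hρ.1 hρ.2] with x hx
    simp only [Function.comp_apply, hH, Real.cos_arccos (by linarith [hx.1] : -1 ≤ x) hx.2.le]
  have hHK (ρ : ℝ) (hρ : ρ ∈ Set.Icc (0 : ℝ) 1) : H ρ = K ρ := by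
    have := intervalIntegral.integral_eq_sub_of_hasDerivAt_of_le hρ.1 hHc.continuousOn
      (fun x hx => hHd x ⟨hx.1, hx.2.trans_le hρ.2⟩) (hhc.intervalIntegrable _ _)
    rw [hK]
    simp only [this]
    ring
  set J : ℝ → ℝ := fun r => ∫ α in (0 : ℝ)..Real.pi, r * (K (r * Real.sin α) * Real.sin α) with hJ
  have hJF (r : ℝ) (hr : r ∈ Set.Icc (0 : ℝ) 1) :
      J r = 4 * Real.pi * ∫ x in (0 : ℝ)..r, F x := by
    have h1 := integral_sphere_coordinate (F := fun x => F (r * x)) (by fun_prop)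
    have h2 : J r = r * ∫ α in (0 : ℝ)..Real.pi, ∫ φ in (0 : ℝ)..2 * Real.pi,
        F (r * (Real.sin α * Real.cos φ)) * Real.sin α := by
      rw [hJ]
      simp only [intervalIntegral.integral_const_mul, intervalIntegral.integral_mul_const]
      congr 1
      refine intervalIntegral.integral_congr fun α hα => ?_
      rw [Set.uIcc_of_le Real.pi_pos.le] at hα
      have hs := Real.sin_nonneg_of_mem_Icc hα
      have := hHK (r * Real.sin α) ⟨mul_nonneg hr.1 hs, mul_le_one₀ hr.2 hs (Real.sin_le_one _)⟩
      simp only [← this, hH, mul_assoc]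
    have h3 : r * ∫ x in (-1 : ℝ)..1, F (r * x) = ∫ x in (-r)..r, F x := by
      simp
    have h4 : ∫ x in (-r)..r, F x = 2 * ∫ x in (0 : ℝ)..r, F x := by
      rw [← intervalIntegral.integral_add_adjacent_intervals (hF.intervalIntegrable _ 0)
        (hF.intervalIntegrable _ _), two_mul]
      congr 1
      have := intervalIntegral.integral_comp_neg (a := 0) (b := r) F
      simpa [heven] using this.symm
    rw [h2, h1, mul_left_comm, h3, h4]
    ring
  have hJd : HasDerivAt J (∫ α in (0 : ℝ)..Real.pi, (K (1 * Real.sin α) * Real.sin α +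
      1 * (h (1 * Real.sin α) * Real.sin α * Real.sin α))) 1 := by
    refine hasDerivAt_intervalIntegral_of_continuous
      (G := fun r α => r * (K (r * Real.sin α) * Real.sin α))
      (G' := fun r α => K (r * Real.sin α) * Real.sin α +
        r * (h (r * Real.sin α) * Real.sin α * Real.sin α))
      (by fun_prop) (by fun_prop) (fun r α => ?_) _ _ _
    have h1 : HasDerivAt (fun r => K (r * Real.sin α)) (h (r * Real.sin α) * Real.sin α) r := by
      simpa [Function.comp_def] using
        (hK' (r * Real.sin α)).comp r ((hasDerivAt_id r).mul_const (Real.sin α))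
    simpa [Pi.mul_def] using (hasDerivAt_id r).mul (h1.mul_const (Real.sin α))
  have hFd : HasDerivAt (fun r => 4 * Real.pi * ∫ x in (0 : ℝ)..r, F x) (4 * Real.pi * F 1) 1 :=
    (intervalIntegral.integral_hasDerivAt_right (hF.intervalIntegrable _ _)
      (hF.stronglyMeasurableAtFilter _ _) hF.continuousAt).const_mul _
  have h1 : (1 : ℝ) ∈ Set.Icc (0 : ℝ) 1 := ⟨zero_le_one, le_rfl⟩
  have heq := (uniqueDiffOn_Icc zero_lt_one (1 : ℝ) h1).eq_deriv _ hJd.hasDerivWithinAt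
    (hFd.hasDerivWithinAt.congr hJF (hJF 1 h1))
  have hparts : ∫ α in (0 : ℝ)..Real.pi, (K (Real.sin α) * Real.sin α -
      h (Real.sin α) * Real.cos α * Real.cos α) = 2 * K 0 := by
    rw [intervalIntegral.integral_eq_sub_of_hasDerivAt
      (f := fun α => -(K (Real.sin α) * Real.cos α)) (fun α _ => ?_)
      (Continuous.intervalIntegrable (by fun_prop) _ _)]
    · simp; ring
    · have h1 : HasDerivAt (fun α => K (Real.sin α)) (h (Real.sin α) * Real.cos α) α :=
        (hK' (Real.sin α)).comp α (Real.hasDerivAt_sin α)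
      convert! (h1.mul (Real.hasDerivAt_cos α)).neg using 1
      ring
  have hsum : 4 * Real.pi * F 1 = 2 * K 0 + ∫ α in (0 : ℝ)..Real.pi, h (Real.sin α) := by
    rw [← heq, ← hparts, ← intervalIntegral.integral_add
      (Continuous.intervalIntegrable (by fun_prop) _ _)
      (Continuous.intervalIntegrable (by fun_prop) _ _)]
    refine intervalIntegral.integral_congr fun α _ => ?_
    simp only [one_mul]
    linear_combination h (Real.sin α) * Real.sin_sq_add_cos_sq α
  have hcos : ∫ α in (0 : ℝ)..Real.pi / 2, h (Real.cos α) =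
      -∫ t in (0 : ℝ)..Real.pi / 2, S t := by
    rw [← intervalIntegral.integral_neg]
    refine intervalIntegral.integral_congr fun α hα => ?_
    rw [Set.uIcc_of_le (by positivity)] at hα
    simp only [hh, Real.arccos_cos hα.1 (by linarith [hα.2, Real.pi_pos])]
  have hK0 : K 0 = 2 * Real.pi * F 0 := by simp [hK, hH]
  rw [integral_comp_sin_zero_pi hhc, hcos, hK0] at hsum
  linarith

/-- The cross product on Euclidean three-space. -/
def vecCross (a b : E 3) : E 3 :=
  !₂[a 1 * b 2 - a 2 * b 1, a 2 * b 0 - a 0 * b 2, a 0 * b 1 - a 1 * b 0]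

theorem real_inner_eq_sum (x y : E 3) : ⟪x, y⟫ = x 0 * y 0 + x 1 * y 1 + x 2 * y 2 := by
  simp [PiLp.inner_apply, Fin.sum_univ_three, mul_comm]

theorem vecCross_vecCross (u v w : E 3) : vecCross u (vecCross v w) = ⟪u, w⟫ • v - ⟪u, v⟫ • w := by
  rw [real_inner_eq_sum, real_inner_eq_sum]
  ext i; fin_cases i <;> simp [vecCross] <;> ring

theorem vecCross_anticomm (u v : E 3) : vecCross u v = -vecCross v u := by
  ext i; fin_cases i <;> simp [vecCross] <;> ring

theorem vecCross_self (u : E 3) : vecCross u u = 0 := by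
  ext i; fin_cases i <;> simp [vecCross] <;> ring

theorem vecCross_add (u v w : E 3) : vecCross u (v + w) = vecCross u v + vecCross u w := by
  ext i; fin_cases i <;> simp [vecCross] <;> ring

theorem vecCross_smul (u v : E 3) (a : ℝ) : vecCross u (a • v) = a • vecCross u v := by
  ext i; fin_cases i <;> simp [vecCross] <;> ring

theorem add_vecCross (u v w : E 3) : vecCross (u + v) w = vecCross u w + vecCross v w := by
  ext i; fin_cases i <;> simp [vecCross] <;> ring

theorem smul_vecCross (u v : E 3) (a : ℝ) : vecCross (a • u) v = a • vecCross u v := by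
  ext i; fin_cases i <;> simp [vecCross] <;> ring

theorem neg_vecCross (u v : E 3) : vecCross (-u) v = -vecCross u v := by
  ext i; fin_cases i <;> simp [vecCross] <;> ring

theorem inner_vecCross_left (u v : E 3) : ⟪u, vecCross u v⟫ = 0 := by
  simp [real_inner_eq_sum, vecCross]; ring

theorem inner_vecCross_right (u v : E 3) : ⟪v, vecCross u v⟫ = 0 := by
  simp [real_inner_eq_sum, vecCross]; ring

theorem inner_vecCross_vecCross (u v : E 3) :
    ⟪vecCross u v, vecCross u v⟫ = ⟪u, u⟫ * ⟪v, v⟫ - ⟪u, v⟫ ^ 2 := by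
  simp only [real_inner_eq_sum]
  simp [vecCross]; ring

theorem contDiff_vecCross {n : WithTop ℕ∞} :
    ContDiff ℝ n fun z : E 3 × E 3 => vecCross z.1 z.2 := by
  rw [contDiff_euclidean]
  intro i
  fin_cases i <;> simp [vecCross] <;> fun_prop

/-- An orthonormal pair; together with `vecCross u p` it forms an oriented orthonormal basis. -/
structure IsFrame (u p : E 3) : Prop where
  norm_left : ‖u‖ = 1
  norm_right : ‖p‖ = 1
  inner_eq_zero : ⟪u, p⟫ = 0

namespace IsFrame

variable {u p : E 3} (h : IsFrame u p)
include h

theorem inner_left : ⟪u, u⟫ = 1 := by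
  rw [real_inner_self_eq_norm_sq, h.norm_left, one_pow]

theorem inner_right : ⟪p, p⟫ = 1 := by
  rw [real_inner_self_eq_norm_sq, h.norm_right, one_pow]

theorem vecCross_vecCross_left : vecCross u (vecCross u p) = -p := by
  rw [vecCross_vecCross, h.inner_eq_zero, h.inner_left]; simp

theorem vecCross_vecCross_right : vecCross p (vecCross u p) = u := by
  rw [vecCross_vecCross, h.inner_right, real_inner_comm, h.inner_eq_zero]; simp

theorem neg_left : IsFrame (-u) p :=
  ⟨by rw [norm_neg, h.norm_left], h.norm_right, by rw [inner_neg_left, h.inner_eq_zero, neg_zero]⟩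

theorem inner_combination (a b c a' b' c' : ℝ) :
    ⟪a • u + b • p + c • vecCross u p, a' • u + b' • p + c' • vecCross u p⟫ =
      a * a' + b * b' + c * c' := by
  have h1 := inner_vecCross_left u p
  have h2 := inner_vecCross_right u p
  have h3 : ⟪vecCross u p, vecCross u p⟫ = 1 := by
    rw [inner_vecCross_vecCross, h.inner_left, h.inner_right, h.inner_eq_zero]; norm_num
  simp only [inner_add_left, inner_add_right, real_inner_smul_left, real_inner_smul_right,
    h1, h2, h3, h.inner_left, h.inner_right, h.inner_eq_zero, real_inner_comm u p,
    real_inner_comm u (vecCross u p), real_inner_comm p (vecCross u p)]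
  ring

theorem norm_sq_combination (a b c : ℝ) :
    ‖a • u + b • p + c • vecCross u p‖ ^ 2 = a ^ 2 + b ^ 2 + c ^ 2 := by
  rw [← real_inner_self_eq_norm_sq, h.inner_combination]; ring

theorem eq_combination (x : E 3) :
    x = ⟪u, x⟫ • u + ⟪p, x⟫ • p + ⟪vecCross u p, x⟫ • vecCross u p := by
  have h1 : vecCross (vecCross u p) (vecCross (vecCross u p) x) =
      ⟪vecCross u p, x⟫ • vecCross u p - ⟪vecCross u p, vecCross u p⟫ • x := vecCross_vecCross _ _ _
  have h3 : ⟪vecCross u p, vecCross u p⟫ = 1 := by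
    rw [inner_vecCross_vecCross, h.inner_left, h.inner_right, h.inner_eq_zero]; norm_num
  have h4 : vecCross (vecCross u p) x = ⟪u, x⟫ • p - ⟪p, x⟫ • u := by
    rw [vecCross_anticomm, vecCross_vecCross, real_inner_comm u x, real_inner_comm p x]; abel
  rw [h3, one_smul, h4, sub_eq_add_neg, vecCross_add, ← neg_smul, vecCross_smul, vecCross_smul,
    vecCross_anticomm _ p, vecCross_anticomm _ u, h.vecCross_vecCross_left,
    h.vecCross_vecCross_right] at h1
  rw [eq_sub_iff_add_eq] at h1
  rw [add_comm (_ + _), ← h1]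
  simp
  abel

end IsFrame

theorem isFrame_normalize {e x : E 3} (h : vecCross e x ≠ 0) :
    IsFrame (‖x‖⁻¹ • x) (‖vecCross e x‖⁻¹ • vecCross e x) where
  norm_left := norm_smul_inv_norm (𝕜 := ℝ) fun hx => h (by
    simpa [hx] using vecCross_smul e 0 0)
  norm_right := norm_smul_inv_norm (𝕜 := ℝ) h
  inner_eq_zero := by
    rw [real_inner_smul_left, real_inner_smul_right, inner_vecCross_right, mul_zero, mul_zero]

theorem exists_vecCross_ne_zero {x : E 3} (hx : x ≠ 0) : ∃ e, vecCross e x ≠ 0 := by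
  by_contra! h
  refine hx ?_
  have h0 := congr_arg (· 0) (h !₂[0, 1, 0])
  have h2 := congr_arg (· 2) (h !₂[1, 0, 0])
  have h3 := congr_arg (· 2) (h !₂[0, 1, 0])
  simp [vecCross] at h0 h2 h3
  ext i; fin_cases i <;> simp [h0, h2, h3]

theorem exists_isFrame {u : E 3} (hu : ‖u‖ = 1) : ∃ p, IsFrame u p := by
  obtain ⟨e, he⟩ := exists_vecCross_ne_zero (x := u) (norm_ne_zero_iff.1 (by simp [hu]))
  exact ⟨_, by simpa [hu] using isFrame_normalize he⟩

/-- The point at angle `θ` of the unit circle spanned by `p` and `q`. -/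
def circlePt (p q : E 3) (θ : ℝ) : E 3 := Real.cos θ • p + Real.sin θ • q

theorem circlePt_add (p q : E 3) (θ α : ℝ) : circlePt p q (θ + α) =
    Real.cos α • circlePt p q θ + Real.sin α • circlePt q (-p) θ := by
  simp only [circlePt, Real.cos_add, Real.sin_add]
  module

theorem circlePt_periodic (p q : E 3) : Function.Periodic (circlePt p q) (2 * Real.pi) := by
  intro θ
  simp [circlePt]

/-- The integral of `k` over the circle with centre `a • u` and radius `b` in the plane spanned by
`p` and `u × p`. -/
def latitudeIntegral (k : E 3 → ℝ) (u p : E 3) (a b : ℝ) : ℝ :=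
  ∫ θ in (0 : ℝ)..2 * Real.pi, k (a • u + b • circlePt p (vecCross u p) θ)

theorem Function.Periodic.intervalIntegral_comp_add {h : ℝ → ℝ} {T : ℝ}
    (hh : Function.Periodic h T)
    (α : ℝ) : ∫ θ in (0 : ℝ)..T, h (θ + α) = ∫ θ in (0 : ℝ)..T, h θ := by
  rw [intervalIntegral.integral_comp_add_right, zero_add, add_comm T]
  simpa using hh.intervalIntegral_add_eq α 0

theorem Function.Periodic.intervalIntegral_comp_neg {h : ℝ → ℝ} {T : ℝ}
    (hh : Function.Periodic h T) :
    ∫ θ in (0 : ℝ)..T, h (-θ) = ∫ θ in (0 : ℝ)..T, h θ := by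
  rw [intervalIntegral.integral_comp_neg]
  simpa using hh.intervalIntegral_add_eq (-T) 0

theorem integral_circlePt_rotate (k : E 3 → ℝ) (u p q : E 3) (a b c : ℝ) :
    ∫ θ in (0 : ℝ)..2 * Real.pi, k (a • u + (b • circlePt p q θ + c • circlePt q (-p) θ)) =
      ∫ θ in (0 : ℝ)..2 * Real.pi, k (a • u + √(b ^ 2 + c ^ 2) • circlePt p q θ) := by
  have hz : ‖(⟨b, c⟩ : ℂ)‖ = √(b ^ 2 + c ^ 2) := by
    rw [Complex.norm_def, Complex.normSq_mk]; ring_nf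
  have hb := Complex.norm_mul_cos_arg ⟨b, c⟩
  have hc := Complex.norm_mul_sin_arg ⟨b, c⟩
  rw [hz] at hb hc
  set α := Complex.arg ⟨b, c⟩
  have hper : Function.Periodic (fun θ => k (a • u + √(b ^ 2 + c ^ 2) • circlePt p q θ))
      (2 * Real.pi) := fun θ => by simp only [circlePt_periodic p q θ]
  rw [← hper.intervalIntegral_comp_add α]
  refine intervalIntegral.integral_congr fun θ _ => ?_
  simp only [circlePt_add p q θ α, smul_add, smul_smul, hb, hc]

theorem latitudeIntegral_abs (k : E 3 → ℝ) (u p : E 3) (a b : ℝ) :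
    latitudeIntegral k u p a |b| = latitudeIntegral k u p a b := by
  have := integral_circlePt_rotate k u p (vecCross u p) a b 0
  simp only [zero_smul, add_zero, ne_eq, OfNat.ofNat_ne_zero, not_false_eq_true, zero_pow,
    Real.sqrt_sq_eq_abs] at this
  exact this.symm

theorem latitudeIntegral_neg_right (k : E 3 → ℝ) (u p : E 3) (a b : ℝ) :
    latitudeIntegral k u p a (-b) = latitudeIntegral k u p a b := by
  rw [← latitudeIntegral_abs, abs_neg, latitudeIntegral_abs]

theorem latitudeIntegral_neg_left {k : E 3 → ℝ} (hk : ∀ x, k (-x) = k x) (u p : E 3) (a b : ℝ) :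
    latitudeIntegral k u p (-a) b = latitudeIntegral k u p a b := by
  rw [← latitudeIntegral_neg_right k u p a]
  refine intervalIntegral.integral_congr fun θ _ => ?_
  rw [← hk]
  congr 1
  module

theorem latitudeIntegral_neg_axis {k : E 3 → ℝ} (hk : ∀ x, k (-x) = k x) (u p : E 3) (a b : ℝ) :
    latitudeIntegral k (-u) p a b = latitudeIntegral k u p a b := by
  have hper : Function.Periodic (fun θ => k (a • u + b • circlePt p (vecCross u p) θ))
      (2 * Real.pi) := fun θ => by simp only [circlePt_periodic p _ θ]
  rw [← latitudeIntegral_neg_left hk (-u), latitudeIntegral, latitudeIntegral,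
    ← hper.intervalIntegral_comp_neg]
  refine intervalIntegral.integral_congr fun θ _ => ?_
  simp only [circlePt, neg_vecCross, Real.cos_neg, Real.sin_neg]
  congr 1
  module

theorem IsFrame.latitudeIntegral_eq {u p p' : E 3} (h : IsFrame u p) (h' : IsFrame u p')
    (k : E 3 → ℝ) (a b : ℝ) : latitudeIntegral k u p' a b = latitudeIntegral k u p a b := by
  have hp' := h.eq_combination p'
  set x := ⟪p, p'⟫
  set y := ⟪vecCross u p, p'⟫
  rw [h'.inner_eq_zero] at hp'
  have hxy : x ^ 2 + y ^ 2 = 1 := by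
    have := h.norm_sq_combination 0 x y
    rw [← hp', h'.norm_right] at this
    linarith
  rw [zero_smul, zero_add] at hp'
  have hq' : vecCross u p' = x • vecCross u p + y • -p := by
    rw [hp', vecCross_add, vecCross_smul, vecCross_smul, h.vecCross_vecCross_left]
  have := integral_circlePt_rotate k u p (vecCross u p) a (b * x) (b * y)
  rw [show (b * x) ^ 2 + (b * y) ^ 2 = b ^ 2 by linear_combination b ^ 2 * hxy,
    Real.sqrt_sq_eq_abs] at this
  rw [← latitudeIntegral_abs k u p, latitudeIntegral, latitudeIntegral, ← this]
  refine intervalIntegral.integral_congr fun θ _ => ?_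
  simp only [circlePt, hq']
  nth_rewrite 1 [hp']
  congr 1
  module

section Commute

variable {u p : E 3} (h : IsFrame u p)
include h

theorem IsFrame.circlePt_left (θ : ℝ) : IsFrame (circlePt p (vecCross u p) θ) u := by
  have hs := h.norm_sq_combination 0 (Real.cos θ) (Real.sin θ)
  rw [zero_smul, zero_add, ← circlePt] at hs
  refine ⟨?_, h.norm_left, ?_⟩
  · rw [← sq_eq_sq₀ (norm_nonneg _) zero_le_one, hs]
    linear_combination Real.sin_sq_add_cos_sq θ
  · have := h.inner_combination 0 (Real.cos θ) (Real.sin θ) 1 0 0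
    simpa [circlePt] using this

theorem IsFrame.vecCross_circlePt (θ : ℝ) : vecCross u (circlePt p (vecCross u p) θ) =
    circlePt (vecCross u p) (-p) θ := by
  rw [circlePt, vecCross_add, vecCross_smul, vecCross_smul, h.vecCross_vecCross_left, circlePt]

theorem IsFrame.tilt (ψ θ : ℝ) : IsFrame
    (Real.sin ψ • u + Real.cos ψ • circlePt p (vecCross u p) θ)
    (Real.cos ψ • u - Real.sin ψ • circlePt p (vecCross u p) θ) := by
  have h' := h.circlePt_left θ
  have e (a b : ℝ) : a • u + b • circlePt p (vecCross u p) θ = b • circlePt p (vecCross u p) θ +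
    a • u + (0 : ℝ) • vecCross (circlePt p (vecCross u p) θ) u := by module
  rw [sub_eq_add_neg, ← neg_smul, e, e]
  refine ⟨?_, ?_, ?_⟩
  · rw [← sq_eq_sq₀ (norm_nonneg _) zero_le_one, h'.norm_sq_combination]
    linear_combination Real.sin_sq_add_cos_sq ψ
  · rw [← sq_eq_sq₀ (norm_nonneg _) zero_le_one, h'.norm_sq_combination]
    linear_combination Real.sin_sq_add_cos_sq ψ
  · rw [h'.inner_combination]
    ring

theorem IsFrame.vecCross_tilt (ψ θ : ℝ) : vecCross
    (Real.sin ψ • u + Real.cos ψ • circlePt p (vecCross u p) θ)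
    (Real.cos ψ • u - Real.sin ψ • circlePt p (vecCross u p) θ) =
    -circlePt (vecCross u p) (-p) θ := by
  have e : vecCross (circlePt p (vecCross u p) θ) u = -circlePt (vecCross u p) (-p) θ := by
    rw [vecCross_anticomm, h.vecCross_circlePt]
  rw [sub_eq_add_neg, ← neg_smul, vecCross_add, add_vecCross, add_vecCross]
  simp only [smul_vecCross, vecCross_smul, vecCross_self, e, h.vecCross_circlePt]
  match_scalars
  linear_combination -Real.sin_sq_add_cos_sq ψ

end Commute

theorem continuous_circlePt (p q : E 3) : Continuous (circlePt p q) := by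
  unfold circlePt
  fun_prop

theorem IsFrame.norm_sq_circlePt_combination {u p : E 3} (h : IsFrame u p) (a b c θ : ℝ) :
    ‖a • u + (b • circlePt p (vecCross u p) θ + c • circlePt (vecCross u p) (-p) θ)‖ ^ 2 =
      a ^ 2 + b ^ 2 + c ^ 2 := by
  have e : a • u + (b • circlePt p (vecCross u p) θ + c • circlePt (vecCross u p) (-p) θ) =
      a • u + (b * Real.cos θ - c * Real.sin θ) • p +
        (b * Real.sin θ + c * Real.cos θ) • vecCross u p := by
    simp only [circlePt]
    module
  rw [e, h.norm_sq_combination]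
  linear_combination (b ^ 2 + c ^ 2) * Real.sin_sq_add_cos_sq θ

theorem IsFrame.norm_sq_latitude {u p : E 3} (h : IsFrame u p) (a b θ : ℝ) :
    ‖a • u + b • circlePt p (vecCross u p) θ‖ ^ 2 = a ^ 2 + b ^ 2 := by
  simpa using h.norm_sq_circlePt_combination a b 0 θ

theorem ne_zero_of_norm_sq {x : E 3} {r : ℝ} (h : ‖x‖ ^ 2 = r) (hr : 0 < r) : x ≠ 0 := by
  rintro rfl
  simp at h
  exact hr.ne h

theorem IsFrame.continuous_latitudeIntegral {u p : E 3} (h : IsFrame u p) {k : E 3 → ℝ}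
    (hk : ContinuousOn k {0}ᶜ) {a b : ℝ → ℝ} (ha : Continuous a) (hb : Continuous b)
    (hab : ∀ t, 0 < a t ^ 2 + b t ^ 2) :
    Continuous fun t => latitudeIntegral k u p (a t) (b t) := by
  refine intervalIntegral.continuous_parametric_intervalIntegral_of_continuous' ?_ _ _
  have := continuous_circlePt p (vecCross u p)
  refine hk.comp_continuous
    (f := fun z : ℝ × ℝ => a z.1 • u + b z.1 • circlePt p (vecCross u p) z.2)
    (by fun_prop) fun z => ?_
  exact ne_zero_of_norm_sq (h.norm_sq_latitude _ _ _) (hab z.1)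

theorem IsFrame.integral_integral_circlePt {u p : E 3} (h : IsFrame u p) {k : E 3 → ℝ}
    (hk : ContinuousOn k {0}ᶜ) {a b c : ℝ → ℝ} (ha : Continuous a) (hb : Continuous b)
    (hc : Continuous c) (habc : ∀ t, 0 < a t ^ 2 + b t ^ 2 + c t ^ 2) :
    ∫ θ in (0 : ℝ)..2 * Real.pi, ∫ φ in (0 : ℝ)..2 * Real.pi,
        k (a φ • u + (b φ • circlePt p (vecCross u p) θ + c φ • circlePt (vecCross u p) (-p) θ)) =
      ∫ φ in (0 : ℝ)..2 * Real.pi, latitudeIntegral k u p (a φ) √(b φ ^ 2 + c φ ^ 2) := by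
  have h1 := continuous_circlePt p (vecCross u p)
  have h2 := continuous_circlePt (vecCross u p) (-p)
  rw [intervalIntegral_swap_of_continuous]
  · exact intervalIntegral.integral_congr fun φ _ => integral_circlePt_rotate k u p _ _ _ _
  · refine hk.comp_continuous (f := fun z : ℝ × ℝ => a z.2 • u +
      (b z.2 • circlePt p (vecCross u p) z.1 + c z.2 • circlePt (vecCross u p) (-p) z.1))
      (by fun_prop) fun z => ?_
    exact ne_zero_of_norm_sq (h.norm_sq_circlePt_combination _ _ _ _) (habc z.2)

/-- The integral of `k` over the circle of points of the unit sphere at height `τ` over `u ^ ⊥`. -/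
def zonalMean (k : E 3 → ℝ) (u p : E 3) (τ : ℝ) : ℝ := latitudeIntegral k u p τ √(1 - τ ^ 2)

theorem zonalMean_neg {k : E 3 → ℝ} (hk : ∀ x, k (-x) = k x) (u p : E 3) (τ : ℝ) :
    zonalMean k u p (-τ) = zonalMean k u p τ := by
  rw [zonalMean, neg_sq, latitudeIntegral_neg_left hk, zonalMean]

theorem zonalMean_zero (k : E 3 → ℝ) (u p : E 3) :
    zonalMean k u p 0 = latitudeIntegral k u p 0 1 := by
  simp [zonalMean]

theorem zonalMean_one (k : E 3 → ℝ) (u p : E 3) : zonalMean k u p 1 = 2 * Real.pi * k u := by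
  simp [zonalMean, latitudeIntegral]

theorem IsFrame.continuous_zonalMean {u p : E 3} (h : IsFrame u p) {k : E 3 → ℝ}
    (hk : ContinuousOn k {0}ᶜ) : Continuous (zonalMean k u p) := by
  refine h.continuous_latitudeIntegral hk continuous_id (by fun_prop) fun t => ?_
  rw [Real.sq_sqrt']
  have := le_max_left (1 - t ^ 2) 0
  have := le_max_right (1 - t ^ 2) 0
  by_contra! hc
  nlinarith [sq_nonneg t]

theorem IsFrame.integral_latitudeIntegral_circlePt {u p : E 3} (h : IsFrame u p) {k : E 3 → ℝ}
    (hk : ContinuousOn k {0}ᶜ) (ψ : ℝ) :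
    ∫ θ in (0 : ℝ)..2 * Real.pi,
        latitudeIntegral k (circlePt p (vecCross u p) θ) u (Real.sin ψ) (Real.cos ψ) =
      ∫ φ in (0 : ℝ)..2 * Real.pi, zonalMean k u p (Real.cos ψ * Real.cos φ) := by
  have e (φ : ℝ) : (Real.sin ψ) ^ 2 + (-(Real.cos ψ * Real.sin φ)) ^ 2 =
      1 - (Real.cos ψ * Real.cos φ) ^ 2 := by
    linear_combination Real.sin_sq_add_cos_sq ψ +
      Real.cos ψ ^ 2 * Real.sin_sq_add_cos_sq φ
  have := h.integral_integral_circlePt hk (a := fun φ => Real.cos ψ * Real.cos φ)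
    (b := fun _ => Real.sin ψ) (c := fun φ => -(Real.cos ψ * Real.sin φ)) (by fun_prop)
    (by fun_prop) (by fun_prop) fun φ => by rw [add_assoc, e]; linarith
  simp only [e] at this
  refine Eq.trans ?_ this
  refine intervalIntegral.integral_congr fun θ _ => ?_
  refine intervalIntegral.integral_congr fun φ _ => ?_
  rw [vecCross_anticomm _ u, h.vecCross_circlePt, circlePt.eq_1 u]
  congr 1
  module

theorem IsFrame.integral_latitudeIntegral_tilt {u p : E 3} (h : IsFrame u p) {k : E 3 → ℝ}
    (hk : ContinuousOn k {0}ᶜ) (ψ : ℝ) :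
    ∫ θ in (0 : ℝ)..2 * Real.pi, latitudeIntegral k
        (Real.sin ψ • u + Real.cos ψ • circlePt p (vecCross u p) θ)
        (Real.cos ψ • u - Real.sin ψ • circlePt p (vecCross u p) θ) 0 1 =
      ∫ φ in (0 : ℝ)..2 * Real.pi, zonalMean k u p (Real.cos ψ * Real.cos φ) := by
  have e (φ : ℝ) : (-(Real.sin ψ * Real.cos φ)) ^ 2 + (-Real.sin φ) ^ 2 =
      1 - (Real.cos ψ * Real.cos φ) ^ 2 := by
    linear_combination Real.sin_sq_add_cos_sq φ +
      Real.cos φ ^ 2 * Real.sin_sq_add_cos_sq ψ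
  have := h.integral_integral_circlePt hk (a := fun φ => Real.cos ψ * Real.cos φ)
    (b := fun φ => -(Real.sin ψ * Real.cos φ)) (c := fun φ => -Real.sin φ) (by fun_prop)
    (by fun_prop) (by fun_prop) fun φ => by rw [add_assoc, e]; linarith
  simp only [e] at this
  refine Eq.trans ?_ this
  refine intervalIntegral.integral_congr fun θ _ => ?_
  refine intervalIntegral.integral_congr fun φ _ => ?_
  rw [h.vecCross_tilt, circlePt.eq_1 (_ - _)]
  congr 1
  module

theorem circle_dist_eq (z w : Circle) : dist z w = ‖(z : ℂ) - w‖ := dist_eq_norm (z : ℂ) w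

instance measurableSpace_circle : MeasurableSpace Circle := borel Circle

instance borelSpace_circle : BorelSpace Circle := ⟨rfl⟩

theorem lipschitzWith_circle_exp : LipschitzWith 1 Circle.exp := by
  refine LipschitzWith.of_dist_le_mul fun x y => ?_
  rw [NNReal.coe_one, one_mul, circle_dist_eq, dist_eq_norm]
  have e : (Circle.exp x : ℂ) - Circle.exp y =
      Circle.exp y * (Complex.exp (Complex.I * (x - y : ℝ)) - 1) := by
    rw [Circle.coe_exp, Circle.coe_exp, mul_sub, ← Complex.exp_add]
    push_cast
    ring_nf
  rw [e, norm_mul, Circle.norm_coe, one_mul]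
  exact Real.norm_exp_I_mul_ofReal_sub_one_le

instance isIsometricSMul_circle : IsIsometricSMul Circle Circle :=
  ⟨fun c => Isometry.of_dist_eq fun x y => by
    rw [circle_dist_eq, circle_dist_eq, smul_eq_mul, smul_eq_mul,
      Circle.coe_mul, Circle.coe_mul, ← mul_sub, norm_mul, Circle.norm_coe, one_mul]⟩

instance isFiniteMeasure_hausdorffMeasure_circle : IsFiniteMeasure (μH[1] : Measure Circle) := by
  refine ⟨?_⟩
  have hs : (Set.univ : Set Circle) = Circle.exp '' Set.Ioc (-Real.pi) Real.pi :=
    (Set.eq_univ_of_univ_subset Circle.surjOn_exp_neg_pi_pi).symm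
  rw [hs]
  refine (lipschitzWith_circle_exp.hausdorffMeasure_image_le zero_le_one _).trans_lt ?_
  rw [hausdorffMeasure_real, Real.volume_Ioc]
  simp

theorem hausdorffMeasure_circle_ne_zero : (μH[1] : Measure Circle) Set.univ ≠ 0 := by
  intro h
  have hre : LipschitzWith 1 fun z : Circle => (z : ℂ).re :=
    LipschitzWith.of_dist_le_mul fun x y => by
      rw [NNReal.coe_one, one_mul, circle_dist_eq, dist_eq_norm, ← Complex.sub_re]
      exact Complex.abs_re_le_norm _
  have hle := hre.hausdorffMeasure_image_le zero_le_one Set.univ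
  rw [h, mul_zero, hausdorffMeasure_real] at hle
  have hsub : Set.Icc (-1 : ℝ) 1 ⊆ (fun z : Circle => (z : ℂ).re) '' Set.univ := fun x hx =>
    ⟨Circle.exp (Real.arccos x), trivial, by
      simp only [Circle.coe_exp, Complex.exp_ofReal_mul_I_re, Real.cos_arccos hx.1 hx.2]⟩
  have := (measure_mono hsub).trans hle
  rw [Real.volume_Icc] at this
  norm_num at this

theorem integral_hausdorffMeasure_circle {φ : Circle → ℝ} (hφ : Continuous φ) :
    2 * Real.pi * ∫ z, φ z ∂μH[1] =
      (μH[1] : Measure Circle).real Set.univ * ∫ θ in (0 : ℝ)..2 * Real.pi, φ (Circle.exp θ) := by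
  have hper (z : Circle) : ∫ θ in (0 : ℝ)..2 * Real.pi, φ (Circle.exp θ * z) =
      ∫ θ in (0 : ℝ)..2 * Real.pi, φ (Circle.exp θ) := by
    obtain ⟨α, rfl⟩ := Circle.exp_surjective z
    have : Function.Periodic (fun θ => φ (Circle.exp θ)) (2 * Real.pi) := fun θ => by
      simp only [Circle.periodic_exp θ]
    simpa only [Circle.exp_add] using this.intervalIntegral_comp_add α
  have hswap : ∫ θ in (0 : ℝ)..2 * Real.pi, ∫ z, φ (Circle.exp θ * z) ∂μH[1] =
      ∫ z, (∫ θ in (0 : ℝ)..2 * Real.pi, φ (Circle.exp θ * z)) ∂μH[1] := by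
    simp only [intervalIntegral.integral_of_le Real.two_pi_pos.le]
    refine integral_integral_swap ?_
    obtain ⟨C, hC⟩ := isCompact_univ.exists_bound_of_continuousOn hφ.continuousOn
    refine Integrable.of_bound (C := C) ?_ (Filter.Eventually.of_forall fun z => hC _ trivial)
    exact Continuous.aestronglyMeasurable (by fun_prop)
  simp only [hper, integral_mul_left_eq_self φ] at hswap
  simpa using hswap

theorem exists_radon_eq : ∃ c : ℝ, 0 < c ∧ ∀ g : E 3 → ℝ, ContinuousOn g (sphere 0 1) →
    ∀ u p, IsFrame u p → radon 3 g u = c * latitudeIntegral g u p 0 1 := by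
  refine ⟨(μH[1] : Measure Circle).real Set.univ / (2 * Real.pi), ?_, fun g hg u p h => ?_⟩
  · exact div_pos (ENNReal.toReal_pos hausdorffMeasure_circle_ne_zero (measure_ne_top _ _))
      Real.two_pi_pos
  set ι : Circle → E 3 := fun z => (z : ℂ).re • p + (z : ℂ).im • vecCross u p with hι
  have hnorm (a b : ℝ) : ‖a • p + b • vecCross u p‖ ^ 2 = a ^ 2 + b ^ 2 := by
    simpa using h.norm_sq_combination 0 a b
  have hiso : Isometry ι := Isometry.of_dist_eq fun z w => by
    rw [circle_dist_eq, dist_eq_norm, ← sq_eq_sq₀ (norm_nonneg _) (norm_nonneg _),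
      ← Complex.normSq_eq_norm_sq, Complex.normSq_apply]
    have e : ι z - ι w = ((z : ℂ) - w).re • p + ((z : ℂ) - w).im • vecCross u p := by
      simp only [hι, Complex.sub_re, Complex.sub_im]
      module
    rw [e, hnorm]
    ring
  have hsq (z : Circle) : (z : ℂ).re ^ 2 + (z : ℂ).im ^ 2 = 1 := by
    have := Circle.normSq_coe z
    rw [Complex.normSq_apply] at this
    linarith
  have hsphere (z : Circle) : ι z ∈ sphere (0 : E 3) 1 := by
    rw [mem_sphere_zero_iff_norm, ← sq_eq_sq₀ (norm_nonneg _) zero_le_one, hnorm, hsq, one_pow]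
  have hrange : Set.range ι = sphere 0 1 ∩ hyperplane u := by
    refine Set.Subset.antisymm ?_ fun x hx => ?_
    · rintro _ ⟨z, rfl⟩
      refine ⟨hsphere z, ?_⟩
      have := h.inner_combination 0 (z : ℂ).re (z : ℂ).im 1 0 0
      simpa [hι, hyperplane] using this
    · have hx1 : ‖x‖ = 1 := by simpa using hx.1
      have hx2 : ⟪u, x⟫ = 0 := by rw [real_inner_comm]; exact hx.2
      have hc := h.eq_combination x
      rw [hx2, zero_smul, zero_add] at hc
      have hz : ⟪p, x⟫ ^ 2 + ⟪vecCross u p, x⟫ ^ 2 = 1 := by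
        rw [← hnorm, ← hc, hx1, one_pow]
      refine ⟨⟨⟨⟪p, x⟫, ⟪vecCross u p, x⟫⟩, ?_⟩, hc.symm⟩
      refine mem_sphere_zero_iff_norm.2 ?_
      rw [← sq_eq_sq₀ (norm_nonneg _) zero_le_one,
        ← Complex.normSq_eq_norm_sq, Complex.normSq_apply]
      linarith
  have hφ : Continuous fun z => g (ι z) := hg.comp_continuous hiso.continuous hsphere
  have hr : radon 3 g u = ∫ z, g (ι z) ∂μH[1] := by
    rw [radon, ← hrange, show ((3 : ℕ) : ℝ) - 2 = 1 by norm_num,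
      ← hiso.map_hausdorffMeasure (Or.inl zero_le_one),
      hiso.isClosedEmbedding.measurableEmbedding.integral_map]
  have hl : latitudeIntegral g u p 0 1 = ∫ θ in (0 : ℝ)..2 * Real.pi, g (ι (Circle.exp θ)) := by
    refine intervalIntegral.integral_congr fun θ _ => ?_
    simp only [hι, circlePt, Circle.coe_exp, Complex.exp_ofReal_mul_I_re,
      Complex.exp_ofReal_mul_I_im, zero_smul, zero_add, one_smul]
  have := integral_hausdorffMeasure_circle hφ
  have hpi := Real.two_pi_pos
  rw [hr, hl, div_mul_eq_mul_div, eq_div_iff hpi.ne', mul_comm, this]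

theorem contDiffOn_latitudeIntegral {X : Type} [NormedAddCommGroup X] [NormedSpace ℝ X]
    [FiniteDimensional ℝ X] {U P : X → E 3} {V : Set X} (hV : IsOpen V)
    (hU : ContDiffOn ℝ (⊤ : ℕ∞) U V) (hP : ContDiffOn ℝ (⊤ : ℕ∞) P V)
    (hUP : ∀ x ∈ V, IsFrame (U x) (P x)) {k : E 3 → ℝ} (hk : ContDiffOn ℝ (⊤ : ℕ∞) k {0}ᶜ) :
    ContDiffOn ℝ (⊤ : ℕ∞) (fun z : X × ℝ =>
      latitudeIntegral k (U z.1) (P z.1) (Real.sin z.2) (Real.cos z.2)) (V ×ˢ Set.univ) := by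
  have key := contDiffOn_intervalIntegral_smul (X := X × ℝ) (Y := ℝ) (U := V ×ˢ Set.univ)
    (Φ := fun z => k (Real.sin z.1.2 • U z.1.1 +
      Real.cos z.1.2 • circlePt (P z.1.1) (vecCross (U z.1.1) (P z.1.1)) z.2))
    (w := fun _ => 1) (hV.prod isOpen_univ) ?_ continuous_const 0 (2 * Real.pi)
  · simpa only [one_smul, latitudeIntegral] using key
  have hm : Set.MapsTo (fun z : (X × ℝ) × ℝ => z.1.1) ((V ×ˢ Set.univ) ×ˢ Set.univ) V :=
    fun z hz => hz.1.1
  have hU' : ContDiffOn ℝ (⊤ : ℕ∞) (fun z : (X × ℝ) × ℝ => U z.1.1)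
      ((V ×ˢ Set.univ) ×ˢ Set.univ) := hU.comp (by fun_prop) hm
  have hP' : ContDiffOn ℝ (⊤ : ℕ∞) (fun z : (X × ℝ) × ℝ => P z.1.1)
      ((V ×ˢ Set.univ) ×ˢ Set.univ) := hP.comp (by fun_prop) hm
  have hQ' : ContDiffOn ℝ (⊤ : ℕ∞) (fun z : (X × ℝ) × ℝ => vecCross (U z.1.1) (P z.1.1))
      ((V ×ˢ Set.univ) ×ˢ Set.univ) := contDiff_vecCross.comp_contDiffOn (hU'.prodMk hP')
  refine hk.comp (g := k) ?_ fun z hz => ?_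
  · have hsin := Real.contDiff_sin (n := (⊤ : ℕ∞))
    have hcos := Real.contDiff_cos (n := (⊤ : ℕ∞))
    have ht : ContDiff ℝ (⊤ : ℕ∞) fun z : (X × ℝ) × ℝ => z.1.2 := by fun_prop
    have hθ : ContDiff ℝ (⊤ : ℕ∞) fun z : (X × ℝ) × ℝ => z.2 := by fun_prop
    exact ((hsin.comp ht).contDiffOn.smul hU').add ((hcos.comp ht).contDiffOn.smul
      (((hcos.comp hθ).contDiffOn.smul hP').add ((hsin.comp hθ).contDiffOn.smul hQ')))
  · refine ne_zero_of_norm_sq ((hUP _ hz.1.1).norm_sq_latitude _ _ _) ?_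
    rw [Real.sin_sq_add_cos_sq]
    exact one_pos

theorem contDiff_circlePt (p q : E 3) {n : WithTop ℕ∞} : ContDiff ℝ n (circlePt p q) :=
  (Real.contDiff_cos.smul contDiff_const).add (Real.contDiff_sin.smul contDiff_const)

/-- Up to a constant factor, the value at `u` of the inverse spherical Radon transform of `k`. -/
def radonInversion (k : E 3 → ℝ) (u p : E 3) : ℝ :=
  2 * Real.pi * k u - sinQuotientIntegral fun t => latitudeIntegral k u p (Real.sin t) (Real.cos t)

theorem IsFrame.radonInversion_eq {u p p' : E 3} (h : IsFrame u p) (h' : IsFrame u p')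
    (k : E 3 → ℝ) : radonInversion k u p' = radonInversion k u p := by
  simp only [radonInversion, h.latitudeIntegral_eq h']

theorem radonInversion_neg {k : E 3 → ℝ} (hk : ∀ x, k (-x) = k x) (u p : E 3) :
    radonInversion k (-u) p = radonInversion k u p := by
  simp only [radonInversion, latitudeIntegral_neg_axis hk, hk]

theorem latitudeIntegral_sin_cos_neg {k : E 3 → ℝ} (hk : ∀ x, k (-x) = k x) (u p : E 3) (t : ℝ) :
    latitudeIntegral k u p (Real.sin (-t)) (Real.cos (-t)) =
      latitudeIntegral k u p (Real.sin t) (Real.cos t) := by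
  rw [Real.sin_neg, Real.cos_neg, latitudeIntegral_neg_left hk]

theorem contDiffOn_sinQuotientIntegral_latitudeIntegral {X : Type} [NormedAddCommGroup X]
    [NormedSpace ℝ X] [FiniteDimensional ℝ X] {U P : X → E 3} {V : Set X} (hV : IsOpen V)
    (hU : ContDiffOn ℝ (⊤ : ℕ∞) U V) (hP : ContDiffOn ℝ (⊤ : ℕ∞) P V)
    (hUP : ∀ x ∈ V, IsFrame (U x) (P x)) {k : E 3 → ℝ} (hk : ContDiffOn ℝ (⊤ : ℕ∞) k {0}ᶜ)
    (hke : ∀ x, k (-x) = k x) :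
    ContDiffOn ℝ (⊤ : ℕ∞) (fun x => sinQuotientIntegral fun t =>
      latitudeIntegral k (U x) (P x) (Real.sin t) (Real.cos t)) V :=
  contDiffOn_sinQuotientIntegral (Φ := fun z : X × ℝ =>
      latitudeIntegral k (U z.1) (P z.1) (Real.sin z.2) (Real.cos z.2)) hV
    (contDiffOn_latitudeIntegral hV hU hP hUP hk)
    fun _ _ t => latitudeIntegral_sin_cos_neg hke _ _ t

theorem IsFrame.norm_circlePt {u p : E 3} (h : IsFrame u p) (θ : ℝ) :
    ‖circlePt p (vecCross u p) θ‖ = 1 :=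
  (h.circlePt_left θ).norm_left

theorem IsFrame.integral_radonInversion {u p : E 3} (h : IsFrame u p) {k : E 3 → ℝ}
    (hk : ContDiffOn ℝ (⊤ : ℕ∞) k {0}ᶜ) (hke : ∀ x, k (-x) = k x) :
    ∫ θ in (0 : ℝ)..2 * Real.pi, radonInversion k (circlePt p (vecCross u p) θ) u =
      4 * Real.pi ^ 2 * k u := by
  have hne (θ : ℝ) : circlePt p (vecCross u p) θ ∈ ({0}ᶜ : Set (E 3)) :=
    norm_ne_zero_iff.1 ((h.norm_circlePt θ).trans_ne one_ne_zero)
  have hω := contDiff_circlePt p (vecCross u p) (n := (⊤ : ℕ∞))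
  have hk1 : Continuous fun θ => k (circlePt p (vecCross u p) θ) :=
    hk.continuousOn.comp_continuous hω.continuous hne
  have hk2 : Continuous fun θ => sinQuotientIntegral fun t =>
      latitudeIntegral k (circlePt p (vecCross u p) θ) u (Real.sin t) (Real.cos t) := by
    rw [← continuousOn_univ]
    exact (contDiffOn_sinQuotientIntegral_latitudeIntegral isOpen_univ hω.contDiffOn
      contDiffOn_const (fun θ _ => h.circlePt_left θ) hk hke).continuousOn
  have hΦ := contDiffOn_latitudeIntegral isOpen_univ hω.contDiffOn contDiffOn_const
    (fun θ _ => h.circlePt_left θ) hk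
  rw [Set.univ_prod_univ, contDiffOn_univ] at hΦ
  obtain ⟨S, hS, hderiv, hint⟩ := exists_hasDerivAt_integral_sinQuotientIntegral hΦ
    (fun _ t => latitudeIntegral_sin_cos_neg hke _ _ t) 0 (2 * Real.pi)
  simp only [h.integral_latitudeIntegral_circlePt hk.continuousOn] at hderiv
  have hinv := schlomilch_inversion (h.continuous_zonalMean hk.continuousOn)
    (zonalMean_neg hke u p) hS hderiv
  rw [zonalMean_one, ← hint, zonalMean_zero] at hinv
  have h0 : latitudeIntegral k u p 0 1 =
      ∫ θ in (0 : ℝ)..2 * Real.pi, k (circlePt p (vecCross u p) θ) := by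
    simp only [latitudeIntegral, zero_smul, zero_add, one_smul]
  simp only [radonInversion]
  rw [intervalIntegral.integral_sub ((hk1.const_mul _).intervalIntegrable _ _)
    (hk2.intervalIntegrable _ _), intervalIntegral.integral_const_mul, ← h0, hinv]
  ring

theorem contDiffOn_normalize : ContDiffOn ℝ (⊤ : ℕ∞) (fun x : E 3 => ‖x‖⁻¹ • x) {0}ᶜ := by
  have h : ContDiffOn ℝ (⊤ : ℕ∞) (fun x : E 3 => ‖x‖) {0}ᶜ := contDiffOn_id.norm ℝ fun _ hx => hx
  exact (h.inv fun _ hx => norm_ne_zero_iff.2 hx).smul contDiffOn_id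

theorem norm_normalize {x : E 3} (hx : x ≠ 0) : ‖‖x‖⁻¹ • x‖ = 1 :=
  norm_smul_inv_norm (𝕜 := ℝ) hx

theorem contDiffOn_radonInversion {k : E 3 → ℝ} (hk : ContDiffOn ℝ (⊤ : ℕ∞) k {0}ᶜ)
    (hke : ∀ x, k (-x) = k x) {P : E 3 → E 3} (hP : ∀ u, ‖u‖ = 1 → IsFrame u (P u)) :
    ContDiffOn ℝ (⊤ : ℕ∞) (fun x => radonInversion k (‖x‖⁻¹ • x) (P (‖x‖⁻¹ • x))) {0}ᶜ := by
  have h1 : ContDiffOn ℝ (⊤ : ℕ∞) (fun x => k (‖x‖⁻¹ • x)) {0}ᶜ :=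
    hk.comp contDiffOn_normalize fun x hx =>
      norm_ne_zero_iff.1 ((norm_normalize hx).trans_ne one_ne_zero)
  refine (contDiffOn_const.mul h1).sub fun x₀ hx₀ => ContDiffAt.contDiffWithinAt ?_
  obtain ⟨e, he⟩ := exists_vecCross_ne_zero hx₀
  have hc : ContDiff ℝ (⊤ : ℕ∞) fun x : E 3 => vecCross e x :=
    contDiff_vecCross.comp (contDiff_const.prodMk contDiff_id)
  have hV : IsOpen {x : E 3 | vecCross e x ≠ 0} := isOpen_ne.preimage hc.continuous
  have hsub : {x : E 3 | vecCross e x ≠ 0} ⊆ {0}ᶜ := by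
    rintro x hx rfl
    exact hx (by simpa using vecCross_smul e 0 0)
  have := contDiffOn_sinQuotientIntegral_latitudeIntegral hV (contDiffOn_normalize.mono hsub)
    (contDiffOn_normalize.comp hc.contDiffOn fun x hx => hx) (fun x hx => isFrame_normalize hx)
    hk hke
  refine (this.contDiffAt (hV.mem_nhds he)).congr_of_eventuallyEq ?_
  filter_upwards [hV.mem_nhds he] with x hx
  simp only [Function.comp,
    (isFrame_normalize hx).latitudeIntegral_eq (hP _ (norm_normalize (hsub hx)))]

theorem eq_zero_of_latitudeIntegral_eq_zero {k : E 3 → ℝ} (hk : ContinuousOn k {0}ᶜ)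
    (hke : ∀ x, k (-x) = k x) (h0 : ∀ u p, IsFrame u p → latitudeIntegral k u p 0 1 = 0)
    {u : E 3} (hu : ‖u‖ = 1) : k u = 0 := by
  obtain ⟨p, h⟩ := exists_isFrame hu
  have hz (ψ : ℝ) : ∫ φ in (0 : ℝ)..2 * Real.pi, zonalMean k u p (Real.cos ψ * Real.cos φ) = 0 := by
    rw [← h.integral_latitudeIntegral_tilt hk]
    simp only [h0 _ _ (h.tilt ψ _), intervalIntegral.integral_zero]
  have hinv := schlomilch_inversion (S := fun _ => 0) (h.continuous_zonalMean hk)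
    (zonalMean_neg hke u p) continuous_const fun t _ => by
      simpa only [hz, mul_zero] using hasDerivAt_const t (0 : ℝ)
  rw [zonalMean_zero, zonalMean_one, h0 u p h] at hinv
  have hpi := Real.pi_ne_zero
  simpa [hpi] using hinv

theorem normalize_neg {k : E 3 → ℝ} (hk : ∀ u ∈ sphere (0 : E 3) 1, k (-u) = k u) (x : E 3) :
    k (‖-x‖⁻¹ • -x) = k (‖x‖⁻¹ • x) := by
  rw [norm_neg, smul_neg]
  rcases eq_or_ne x 0 with rfl | hx
  · simp
  · exact hk _ (mem_sphere_zero_iff_norm.2 (norm_normalize hx))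

theorem normalize_of_norm_eq_one {u : E 3} (hu : ‖u‖ = 1) : ‖u‖⁻¹ • u = u := by
  rw [hu, inv_one, one_smul]

theorem SmoothOnSphere.continuousOn_sphere {k : E 3 → ℝ} (hk : SmoothOnSphere k) :
    ContinuousOn k (sphere 0 1) := by
  refine (hk.continuousOn.mono fun u hu => ne_zero_of_mem_unit_sphere ⟨u, hu⟩).congr fun u hu => ?_
  simp only [normalize_of_norm_eq_one (mem_sphere_zero_iff_norm.1 hu)]

theorem IsFrame.latitudeIntegral_congr {u p : E 3} (h : IsFrame u p) {k k' : E 3 → ℝ}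
    (hk : Set.EqOn k k' (sphere 0 1)) :
    latitudeIntegral k u p 0 1 = latitudeIntegral k' u p 0 1 := by
  refine intervalIntegral.integral_congr fun θ _ => hk ?_
  rw [zero_smul, zero_add, one_smul, mem_sphere_zero_iff_norm, h.norm_circlePt]

theorem latitudeIntegral_sub {u p : E 3} (h : IsFrame u p) {k k' : E 3 → ℝ}
    (hk : ContinuousOn k (sphere 0 1)) (hk' : ContinuousOn k' (sphere 0 1)) :
    latitudeIntegral (fun x => k x - k' x) u p 0 1 =
      latitudeIntegral k u p 0 1 - latitudeIntegral k' u p 0 1 := by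
  have hω := continuous_circlePt p (vecCross u p)
  have hm (θ : ℝ) : (0 : ℝ) • u + (1 : ℝ) • circlePt p (vecCross u p) θ ∈ sphere (0 : E 3) 1 := by
    rw [zero_smul, zero_add, one_smul, mem_sphere_zero_iff_norm, h.norm_circlePt]
  exact intervalIntegral.integral_sub
    ((hk.comp_continuous (by fun_prop) hm).intervalIntegrable _ _)
    ((hk'.comp_continuous (by fun_prop) hm).intervalIntegrable _ _)

theorem eqOn_sphere_of_radon_eq {g g' : E 3 → ℝ}
    (hge : ∀ u ∈ sphere (0 : E 3) 1, g (-u) = g u) (hgs : SmoothOnSphere g)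
    (hge' : ∀ u ∈ sphere (0 : E 3) 1, g' (-u) = g' u) (hgs' : SmoothOnSphere g')
    (h : ∀ u ∈ sphere (0 : E 3) 1, radon 3 g' u = radon 3 g u) :
    Set.EqOn g' g (sphere (0 : E 3) 1) := by
  obtain ⟨c, hc, hradon⟩ := exists_radon_eq
  intro u hu
  have hu1 := mem_sphere_zero_iff_norm.1 hu
  have := eq_zero_of_latitudeIntegral_eq_zero
    (k := fun x => g' (‖x‖⁻¹ • x) - g (‖x‖⁻¹ • x)) (hgs'.continuousOn.sub hgs.continuousOn)
    (fun x => by rw [normalize_neg hge', normalize_neg hge]) (fun v p hvp => ?_) hu1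
  · rw [normalize_of_norm_eq_one hu1] at this
    exact sub_eq_zero.1 this
  have hv := h v (mem_sphere_zero_iff_norm.2 hvp.norm_left)
  rw [hradon _ hgs'.continuousOn_sphere v p hvp, hradon _ hgs.continuousOn_sphere v p hvp] at hv
  rw [hvp.latitudeIntegral_congr (k' := fun x => g' x - g x) fun x hx => by
      simp only [normalize_of_norm_eq_one (mem_sphere_zero_iff_norm.1 hx)],
    latitudeIntegral_sub hvp hgs'.continuousOn_sphere hgs.continuousOn_sphere,
    mul_left_cancel₀ hc.ne' hv, sub_self]

/-- Invertibility of the spherical Radon transform on smooth even functions on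
`S²`: for every even `C^∞` function `f` there is a unique even `C^∞` function
`g` with `Rg = f`. -/
theorem radon_transform_invertible_smooth_even (f : E 3 → ℝ)
    (hfe : ∀ u ∈ sphere (0 : E 3) 1, f (-u) = f u)
    (hfs : SmoothOnSphere f) :
    ∃ g : E 3 → ℝ,
      ((∀ u ∈ sphere (0 : E 3) 1, g (-u) = g u) ∧ SmoothOnSphere g ∧
        ∀ u ∈ sphere (0 : E 3) 1, radon 3 g u = f u) ∧
      ∀ g' : E 3 → ℝ,
        ((∀ u ∈ sphere (0 : E 3) 1, g' (-u) = g' u) ∧ SmoothOnSphere g' ∧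
          ∀ u ∈ sphere (0 : E 3) 1, radon 3 g' u = f u) →
        Set.EqOn g' g (sphere (0 : E 3) 1) := by
  obtain ⟨c, hc, hradon⟩ := exists_radon_eq
  choose! P hP using fun u : E 3 => exists_isFrame (u := u)
  set k : E 3 → ℝ := fun x => f (‖x‖⁻¹ • x)
  have hke : ∀ x, k (-x) = k x := normalize_neg hfe
  have hpi := Real.pi_ne_zero
  set g : E 3 → ℝ := fun x => (c * (4 * Real.pi ^ 2))⁻¹ * radonInversion k x (P x) with hg
  have hgs : SmoothOnSphere g := contDiffOn_const.mul (contDiffOn_radonInversion hfs hke hP)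
  have hge : ∀ u ∈ sphere (0 : E 3) 1, g (-u) = g u := fun u hu => by
    rw [mem_sphere_zero_iff_norm] at hu
    simp only [hg]
    rw [(hP u hu).neg_left.radonInversion_eq (hP (-u) (by rwa [norm_neg])),
      radonInversion_neg hke]
  have hgf : ∀ u ∈ sphere (0 : E 3) 1, radon 3 g u = f u := fun u hu => by
    rw [mem_sphere_zero_iff_norm] at hu
    have h := hP u hu
    have hl : latitudeIntegral g u (P u) 0 1 = (c * (4 * Real.pi ^ 2))⁻¹ *
        ∫ θ in (0 : ℝ)..2 * Real.pi, radonInversion k (circlePt (P u) (vecCross u (P u)) θ) u := by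
      rw [← intervalIntegral.integral_const_mul]
      refine intervalIntegral.integral_congr fun θ _ => ?_
      simp only [hg, zero_smul, zero_add, one_smul]
      rw [(h.circlePt_left θ).radonInversion_eq (hP _ (h.norm_circlePt θ))]
    rw [hradon g hgs.continuousOn_sphere u (P u) h, hl, h.integral_radonInversion hfs hke,
      normalize_of_norm_eq_one hu]
    field_simp
  exact ⟨g, ⟨hge, hgs, hgf⟩, fun g' ⟨hge', hgs', hgf'⟩ =>
    eqOn_sphere_of_radon_eq hge hgs hge' hgs' fun u hu => (hgf' u hu).trans (hgf u hu).symm⟩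
end
end
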